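/- Let 0 < σ < 1, fix 0 < c < min{σ/4, (1−σ)/4} and 0 < c' < min{σ/3, (1−σ)/3}. Let δ > 0 and let A ⊂ [1,2] be a (δ,σ)-set which is approximately closed under addition (i.e. N_δ(A+A) ≲ |A|) or approximately closed under subtraction (i.e. N_δ(A−A) ≲ |A|). Then N_δ(A·A) ≥ C(c,σ) · δ^{-c} · |A| and N_δ(A/A) ≥ C(c',σ) · δ^{-c'} · |A|. -/

import Mathlib

open Pointwise

/-- The least number of closed intervals of length `δ` needed to cover `S ⊆ ℝ`. -/
noncomputable def coveringNumber (δ : ℝ) (S : Set ℝ) : ℕ :=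
  sInf {n : ℕ | ∃ t : Finset ℝ, t.card = n ∧ S ⊆ ⋃ x ∈ t, Set.Icc x (x + δ)}

/-- The quotient set `A/B = {a/b : a ∈ A, b ∈ B, b ≠ 0}`. -/
def divSet (A B : Set ℝ) : Set ℝ := {x | ∃ a ∈ A, ∃ b ∈ B, b ≠ 0 ∧ x = a / b}

/-- `A` is a `(δ,σ)`-set with (multiplicative) constant `K`: it is `δ`-separated,
`|A|` is comparable to `δ^{-σ}`, and it satisfies the Frostman condition. -/
def IsDeltaSigmaSet (K δ σ : ℝ) (A : Finset ℝ) : Prop :=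
  (∀ x ∈ A, ∀ y ∈ A, x ≠ y → δ ≤ |x - y|) ∧
  (A.card : ℝ) ≤ K * δ ^ (-σ) ∧
  δ ^ (-σ) ≤ K * (A.card : ℝ) ∧
  ∀ (x r : ℝ), δ ≤ r →
    ((A.filter (fun a => |a - x| ≤ r)).card : ℝ) ≤ K * r ^ σ * (A.card : ℝ)


/-- upward filling of a set of scales -/
def fillSet (U : Finset ℕ) (K z : ℕ) : Finset ℕ :=
  (Finset.range z).filter (fun w => ∃ u ∈ U, u ≤ w ∧ w < u + K)

/-- number of elements below z -/
def cntBelow (U : Finset ℕ) (z : ℕ) : ℕ := (U.filter (fun u => u < z)).card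

/-- truncated sumset -/
def sumTrunc (T W : Finset ℕ) (z : ℕ) : Finset ℕ :=
  (Finset.range z).filter (fun w => ∃ t ∈ T, ∃ j ∈ W, w = t + j)

lemma schnirelmann_aux (v : ℝ) (W : Finset ℕ) (k : ℕ) :
    ∀ (z : ℕ) (T : Finset ℕ), T.card = k + 1 → 0 ∈ T → (∀ t ∈ T, t < z) →
    (∀ l : ℕ, 1 ≤ l → l ≤ z → 1 + v * ((l : ℝ) - 1) ≤ (cntBelow W l : ℝ)) →
    v * z + (1 - v) * T.card ≤ ((sumTrunc T W z).card : ℝ) := by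
  induction k with
  | zero =>
    intro z T hc h0 hlt hW
    have hz : 1 ≤ z := by have := hlt 0 h0; omega
    have h1 := hW z hz le_rfl
    have h2 : (W.filter (fun u => u < z)) ⊆ sumTrunc T W z := by
      intro j hj
      simp only [Finset.mem_filter] at hj
      simp only [sumTrunc, Finset.mem_filter, Finset.mem_range]
      exact ⟨hj.2, 0, h0, j, hj.1, by omega⟩
    have h3 : (cntBelow W z : ℝ) ≤ (sumTrunc T W z).card := by
      exact_mod_cast Finset.card_le_card h2
    rw [hc]; push_cast; linarith
  | succ k ih =>
    intro z T hc h0 hlt hW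
    have hne : T.Nonempty := ⟨0, h0⟩
    set t := T.max' hne with ht
    have htT : t ∈ T := Finset.max'_mem _ _
    have htz := hlt t htT
    have htpos : t ≠ 0 := by
      intro h
      have : T ⊆ {0} := by
        intro s hs
        have := Finset.le_max' T s hs
        rw [← ht, h] at this
        simp; omega
      have := Finset.card_le_card this
      simp at this; omega
    have hi := ih t (T.erase t) (by rw [Finset.card_erase_of_mem htT]; omega)
      (Finset.mem_erase.2 ⟨fun h => htpos h.symm, h0⟩)
      (by
        intro s hs
        rw [Finset.mem_erase] at hs
        have := Finset.le_max' T s hs.2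
        rw [← ht] at this
        omega)
      (fun l h1 h2 => hW l h1 (by omega))
    have h1 := hW (z - t) (by omega) (by omega)
    have hdis : Disjoint (sumTrunc (T.erase t) W t)
        ((W.filter (fun u => u < z - t)).image (fun j => t + j)) := by
      rw [Finset.disjoint_left]
      intro a ha hb
      simp only [sumTrunc, Finset.mem_filter, Finset.mem_range] at ha
      simp only [Finset.mem_image] at hb
      obtain ⟨j, _, rfl⟩ := hb
      omega
    have hsub : (sumTrunc (T.erase t) W t) ∪
        ((W.filter (fun u => u < z - t)).image (fun j => t + j)) ⊆ sumTrunc T W z := by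
      intro a ha
      rw [Finset.mem_union] at ha
      rcases ha with ha | ha
      · simp only [sumTrunc, Finset.mem_filter, Finset.mem_range] at ha ⊢
        obtain ⟨h, s, hs, j, hj, e⟩ := ha
        exact ⟨by omega, s, Finset.mem_of_mem_erase hs, j, hj, e⟩
      · simp only [Finset.mem_image, Finset.mem_filter] at ha
        obtain ⟨j, ⟨hj, hj2⟩, rfl⟩ := ha
        simp only [sumTrunc, Finset.mem_filter, Finset.mem_range]
        exact ⟨by omega, t, htT, j, hj, rfl⟩
    have hcard := Finset.card_le_card hsub
    rw [Finset.card_union_of_disjoint hdis, Finset.card_image_of_injective _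
      (fun a b h => by simpa using h)] at hcard
    have hcard' : ((sumTrunc (T.erase t) W t).card : ℝ) + (cntBelow W (z - t) : ℝ)
        ≤ (sumTrunc T W z).card := by exact_mod_cast hcard
    rw [Finset.card_erase_of_mem htT, hc, show k + 1 + 1 - 1 = k + 1 from rfl] at hi
    rw [Nat.cast_sub htz.le] at h1
    rw [hc]
    push_cast at *
    linarith

/-- the improvement map -/
noncomputable def fmap (s v : ℝ) : ℝ := (2 * s * (1 - v) + v) / (2 - v)

lemma comb_step (s v v' C1 C : ℝ) (C2 : ℕ → ℝ) (hs0 : 0 < s) (hs1 : s < 1)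
    (hv'0 : 0 < v') (hvv : v' < v) (hv1 : v ≤ 1) (hC1 : 0 ≤ C1) (hC : 0 ≤ C)
    (hC2 : ∀ K, 0 ≤ C2 K) :
    ∃ C' : ℝ, 0 ≤ C' ∧ ∀ (n : ℕ) (Us U : Finset ℕ) (T : ℕ → Finset ℕ),
      (∀ z, ∀ t ∈ T z, t < z) →
      (∀ z ≤ n, 2 * s * z - C1 - (T z).card ≤ (cntBelow Us z : ℝ)) →
      (∀ K, 1 ≤ K → ∀ z ≤ n, ((fillSet U K z).card : ℝ) ≤ cntBelow Us z + C2 K) →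
      (∀ u ∈ Us, ∃ w ∈ U, w ≤ u + 1 ∧ u ≤ w + 1) →
      (∀ z ≤ n, ∀ t ∈ T z, ∀ u ∈ Us, t + u + 3 ≤ z → ∃ w ∈ U, w ≤ t + u + 1 ∧ t + u ≤ w + 1) →
      (∀ z ≤ n, v * z - C ≤ (cntBelow Us z : ℝ)) →
      ∀ z ≤ n, fmap s v' * z - C' ≤ (cntBelow Us z : ℝ) := by
  have hv0 : 0 < v := by linarith
  obtain ⟨s0, hs0'⟩ := exists_nat_ge ((C + 1) / v)
  obtain ⟨k1, hk1⟩ := exists_nat_ge ((C + s0 + 1) / (v - v'))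
  set K' : ℕ := s0 + k1 + 1 with hK'
  have hs0v : C + 1 ≤ v * s0 := by
    rw [div_le_iff₀ hv0] at hs0'; linarith
  have hk1v : C + s0 + 1 ≤ (v - v') * k1 := by
    rw [div_le_iff₀ (by linarith)] at hk1; linarith
  have hf1 : fmap s v' ≤ 1 := by
    unfold fmap; rw [div_le_one (by linarith)]
    nlinarith
  have hf0 : 0 ≤ fmap s v' := by
    unfold fmap
    apply div_nonneg <;> nlinarith
  refine ⟨C2 (K' + 2) + C1 + s0 + 3, by have := hC2 (K' + 2); positivity, ?_⟩
  intro n Us U T hT hii hiii hiv0 hiv hP z hz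
  have hC2K := hC2 (K' + 2)
  by_cases hzs : z < s0 + 1
  · have h1 : (z : ℝ) ≤ s0 := by exact_mod_cast (by omega : z ≤ s0)
    have h2 : (0 : ℝ) ≤ cntBelow Us z := by positivity
    have h3 : fmap s v' * z ≤ 1 * z := by gcongr
    linarith
  push Not at hzs
  -- an element of Us below s0
  have hu0 : ∃ u0 ∈ Us, u0 < s0 := by
    have h := hP s0 (by omega)
    have h' : (1 : ℝ) ≤ cntBelow Us s0 := by linarith
    have h'' : 1 ≤ cntBelow Us s0 := by exact_mod_cast h'
    unfold cntBelow at h''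
    obtain ⟨u, hu⟩ := Finset.card_pos.1 (by omega : 0 < (Us.filter (fun u => u < s0)).card)
    rw [Finset.mem_filter] at hu
    exact ⟨u, hu⟩
  obtain ⟨u0, hu0, hu0s⟩ := hu0
  set W : Finset ℕ := (Finset.range z).filter
    (fun j => ∃ u ∈ Us, u ≤ s0 + j ∧ s0 + j < u + K') with hWdef
  have hW : ∀ l : ℕ, 1 ≤ l → l ≤ z → 1 + v' * ((l : ℝ) - 1) ≤ (cntBelow W l : ℝ) := by
    intro l hl1 hlz
    by_cases hl : l ≤ k1
    · have : Finset.range l ⊆ W.filter (fun u => u < l) := by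
        intro j hj
        rw [Finset.mem_range] at hj
        simp only [hWdef, Finset.mem_filter, Finset.mem_range]
        exact ⟨⟨by omega, u0, hu0, by omega, by omega⟩, hj⟩
      have h2 := Finset.card_le_card this
      rw [Finset.card_range] at h2
      have h3 : (l : ℝ) ≤ cntBelow W l := by exact_mod_cast h2
      have h4 : (1 : ℝ) ≤ l := by exact_mod_cast hl1
      nlinarith
    · push Not at hl
      have h1 := hP l (by omega)
      have h2 : cntBelow Us l ≤ s0 + cntBelow W l := by
        have hsub : Us.filter (fun u => u < l) ⊆ Finset.range s0 ∪
            (W.filter (fun u => u < l)).image (fun j => s0 + j) := by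
          intro u hu
          rw [Finset.mem_filter] at hu
          rw [Finset.mem_union, Finset.mem_range, Finset.mem_image]
          by_cases h : u < s0
          · left; exact h
          · right
            refine ⟨u - s0, ?_, by omega⟩
            simp only [hWdef, Finset.mem_filter, Finset.mem_range]
            exact ⟨⟨by omega, u, hu.1, by omega, by omega⟩, by omega⟩
        calc cntBelow Us l ≤ _ := Finset.card_le_card hsub
          _ ≤ _ := Finset.card_union_le _ _
          _ ≤ s0 + cntBelow W l := by
            rw [Finset.card_range]
            gcongr
            exact Finset.card_image_le
      have h2' : (cntBelow Us l : ℝ) ≤ s0 + cntBelow W l := by exact_mod_cast h2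
      have h3 : (k1 : ℝ) ≤ l := by exact_mod_cast hl.le
      have h5 : (v - v') * k1 ≤ (v - v') * l := by
        apply mul_le_mul_of_nonneg_left h3; linarith
      nlinarith
  set T0 := insert 0 (T z) with hT0
  have hT0z : ∀ t ∈ T0, t < z := by
    intro t ht
    rw [hT0, Finset.mem_insert] at ht
    rcases ht with rfl | ht
    · omega
    · exact hT z t ht
  have hT0c : 1 ≤ T0.card := Finset.card_pos.2 ⟨0, Finset.mem_insert_self _ _⟩
  have hS := schnirelmann_aux v' W (T0.card - 1) z T0 (by omega)
    (Finset.mem_insert_self _ _) hT0z hW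
  have hTT : ((T z).card : ℝ) ≤ T0.card := by
    exact_mod_cast Finset.card_le_card (Finset.subset_insert _ _)
  -- embedding
  have hemb : (sumTrunc T0 W z).card ≤ (fillSet U (K' + 2) z).card + (s0 + 3) := by
    have hsub : sumTrunc T0 W z ⊆ Finset.Ico (z - (s0 + 3)) z ∪
        (fillSet U (K' + 2) z).image (fun w => w - (s0 + 1)) := by
      intro e he
      simp only [sumTrunc, Finset.mem_filter, Finset.mem_range] at he
      obtain ⟨hez, t, ht, j, hj, rfl⟩ := he
      rw [Finset.mem_union, Finset.mem_Ico, Finset.mem_image]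
      by_cases h : z - (s0 + 3) ≤ t + j
      · left; exact ⟨h, hez⟩
      · right
        push Not at h
        simp only [hWdef, Finset.mem_filter, Finset.mem_range] at hj
        obtain ⟨_, u, hu, hu1, hu2⟩ := hj
        refine ⟨t + j + (s0 + 1), ?_, by omega⟩
        simp only [fillSet, Finset.mem_filter, Finset.mem_range]
        refine ⟨by omega, ?_⟩
        have : ∃ w ∈ U, w ≤ t + u + 1 ∧ t + u ≤ w + 1 := by
          rw [hT0, Finset.mem_insert] at ht
          rcases ht with rfl | ht
          · simpa using hiv0 u hu
          · exact hiv z hz t ht u hu (by omega)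
        obtain ⟨w, hw, hw1, hw2⟩ := this
        exact ⟨w, hw, by omega, by omega⟩
    have h1 := Finset.card_le_card hsub
    have h2 := Finset.card_union_le (Finset.Ico (z - (s0 + 3)) z)
      ((fillSet U (K' + 2) z).image (fun w => w - (s0 + 1)))
    have h3 : ((fillSet U (K' + 2) z).image (fun w => w - (s0 + 1))).card ≤
      (fillSet U (K' + 2) z).card := Finset.card_image_le
    rw [Nat.card_Ico] at h2
    omega
  have hemb' : ((sumTrunc T0 W z).card : ℝ) ≤ (fillSet U (K' + 2) z).card + (s0 + 3) := by
    exact_mod_cast hemb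
  have h3 := hiii (K' + 2) (by omega) z hz
  have h2 := hii z hz
  set g : ℝ := (cntBelow Us z : ℝ)
  have key : (2 * s * (1 - v') + v') * z - (C2 (K' + 2) + C1 + s0 + 3) ≤ (2 - v') * g := by
    have h4 : (1 - v') * (2 * s * z - C1 - g) ≤ (1 - v') * T0.card := by
      apply mul_le_mul_of_nonneg_left _ (by linarith); linarith
    nlinarith
  have h2v : 1 ≤ 2 - v' := by linarith
  have : fmap s v' * z = ((2 * s * (1 - v') + v') * z) / (2 - v') := by
    unfold fmap; ring
  rw [this, sub_le_iff_le_add, div_le_iff₀ (by linarith)]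
  have : (C2 (K' + 2) + C1 + s0 + 3) * 1 ≤ (C2 (K' + 2) + C1 + s0 + 3) * (2 - v') := by
    apply mul_le_mul_of_nonneg_left h2v; positivity
  nlinarith

lemma fmap_exists (s th : ℝ) (hs0 : 0 < s) (hs1 : s < 1)
    (hth : th < min s (1 - s) / 2) :
    ∃ v1 v2 : ℝ, 0 < v1 ∧ v1 < s ∧ 0 < v2 ∧ v2 < fmap s v1 ∧ fmap s v1 ≤ 1 ∧ 
      s + th < fmap s v2 := by
  have hfc : ∀ v < 2, ContinuousAt (fmap s) v := by
    intro v hv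
    unfold fmap
    apply ContinuousAt.div (by fun_prop) (by fun_prop) (by linarith)
  have hfs : s < fmap s s := by
    unfold fmap; rw [lt_div_iff₀ (by linarith)]; nlinarith [mul_pos hs0 (by linarith : 0 < 1 - s)]
  have hle1 : ∀ v, v ≤ 1 → fmap s v ≤ 1 := by
    intro v hv
    unfold fmap; rw [div_le_one (by linarith)]; nlinarith
  have hff : s + th < fmap s (fmap s s) := by
    have e : fmap s (fmap s s) - s = s * (3 - 2 * s) * (1 - s) / (4 - 5 * s + 2 * s ^ 2) := by
      have h1 : (2 - s) ≠ 0 := by linarith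
      have h2 : (4 - 5 * s + 2 * s ^ 2) ≠ 0 := by nlinarith [sq_nonneg (4 * s - 5)]
      have h3 : 2 - (2 * s * (1 - s) + s) / (2 - s) = (4 - 5 * s + 2 * s ^ 2) / (2 - s) := by
        field_simp; ring
      have h4 : fmap s s = (2 * s * (1 - s) + s) / (2 - s) := rfl
      have h5 : fmap s s * (2 - s) = s * (3 - 2 * s) := by
        rw [h4]; field_simp; ring
      have h6 : fmap s (fmap s s) = (2 * s * (1 - fmap s s) + fmap s s) / (2 - fmap s s) := rfl
      have h7 : 2 - fmap s s = (4 - 5 * s + 2 * s ^ 2) / (2 - s) := h3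
      have h8 : 2 * s * (1 - fmap s s) + fmap s s =
          (s * (7 - 10 * s + 4 * s ^ 2)) / (2 - s) := by
        rw [eq_div_iff h1]
        linear_combination (1 - 2 * s) * h5
      rw [h6, h7, h8, div_div_div_cancel_right₀ h1, sub_eq_iff_eq_add, div_add' _ _ _ h2,
        div_left_inj' h2]
      ring
    have hpos : 0 < 4 - 5 * s + 2 * s ^ 2 := by nlinarith [sq_nonneg (4 * s - 5)]
    have : min s (1 - s) / 2 ≤ s * (3 - 2 * s) * (1 - s) / (4 - 5 * s + 2 * s ^ 2) := by
      rw [le_div_iff₀ hpos]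
      rcases le_total s (1 / 2) with h | h
      · rw [min_eq_left (by linarith)]
        have : 0 ≤ s * ((1 - 2 * s) * (2 - s)) := by
          apply mul_nonneg hs0.le; apply mul_nonneg <;> linarith
        nlinarith
      · rw [min_eq_right (by linarith)]
        have : 0 ≤ (1 - s) * ((2 * s - 1) * (4 - 3 * s)) := by
          apply mul_nonneg (by linarith); apply mul_nonneg <;> linarith
        nlinarith
    linarith
  have h1 : ∀ᶠ v2 in nhds (fmap s s), s + th < fmap s v2 ∧ 0 < v2 := by
    refine ((hfc _ (by have := hle1 s hs1.le; linarith)).eventually (lt_mem_nhds hff)).and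
      (lt_mem_nhds (by linarith))
  obtain ⟨v2, ⟨h2a, h2b⟩, h2c⟩ := ((h1.filter_mono (nhdsWithin_le_nhds (s := Set.Iio (fmap s s)))).and
    self_mem_nhdsWithin).exists
  have h3 : ∀ᶠ v1 in nhds s, v2 < fmap s v1 ∧ 0 < v1 :=
    ((hfc s (by linarith)).eventually (lt_mem_nhds h2c)).and (lt_mem_nhds hs0)
  obtain ⟨v1, ⟨h4a, h4b⟩, h4c⟩ := ((h3.filter_mono (nhdsWithin_le_nhds (s := Set.Iio s))).and
    self_mem_nhdsWithin).exists
  have h4c' : v1 < s := h4c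
  exact ⟨v1, v2, h4b, h4c, h2b, h4a, hle1 v1 (by linarith), h2a⟩

lemma comb_main (s th C1 : ℝ) (C2 : ℕ → ℝ) (hs0 : 0 < s) (hs1 : s < 1)
    (hth : th < min s (1 - s) / 2) (hC1 : 0 ≤ C1) (hC2 : ∀ K, 0 ≤ C2 K) :
    ∃ C' : ℝ, ∃ th' > th, 0 ≤ C' ∧ ∀ (n : ℕ) (Us U : Finset ℕ) (T : ℕ → Finset ℕ),
      (∀ z, ∀ t ∈ T z, t < z) →
      (∀ z ≤ n, 2 * s * z - C1 - (T z).card ≤ (cntBelow Us z : ℝ)) →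
      (∀ K, 1 ≤ K → ∀ z ≤ n, ((fillSet U K z).card : ℝ) ≤ cntBelow Us z + C2 K) →
      (∀ u ∈ Us, ∃ w ∈ U, w ≤ u + 1 ∧ u ≤ w + 1) →
      (∀ z ≤ n, ∀ t ∈ T z, ∀ u ∈ Us, t + u + 3 ≤ z → ∃ w ∈ U, w ≤ t + u + 1 ∧ t + u ≤ w + 1) →
      (∀ z ≤ n, s * z - C1 ≤ (cntBelow Us z : ℝ)) →
      (s + th') * n - C' ≤ (cntBelow Us n : ℝ) := by
  obtain ⟨v1, v2, h1, h2, h3, h4, h5, h6⟩ := fmap_exists s th hs0 hs1 hth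
  obtain ⟨Ca, hCa, Ha⟩ := comb_step s s v1 C1 C1 C2 hs0 hs1 h1 h2 hs1.le hC1 hC1 hC2
  obtain ⟨Cb, hCb, Hb⟩ := comb_step s (fmap s v1) v2 C1 Ca C2 hs0 hs1 h3 h4 h5 hC1 hCa hC2
  refine ⟨Cb, fmap s v2 - s, by linarith, hCb, ?_⟩
  intro n Us U T hT hii hiii hiv0 hiv hP
  have := Hb n Us U T hT hii hiii hiv0 hiv (Ha n Us U T hT hii hiii hiv0 hiv hP) n le_rfl
  linarith
/-- discretisation -/
noncomputable def flo (δ : ℝ) (A : Finset ℝ) : Finset ℤ := A.image (fun a => ⌊a / δ⌋)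

lemma covering_attained (δ : ℝ) (hδ : 0 < δ) (S : Set ℝ) (hS : S.Finite) :
    ∃ t : Finset ℝ, t.card = coveringNumber δ S ∧ S ⊆ ⋃ x ∈ t, Set.Icc x (x + δ) := by
  have hne : {n : ℕ | ∃ t : Finset ℝ, t.card = n ∧ S ⊆ ⋃ x ∈ t, Set.Icc x (x + δ)}.Nonempty := by
    refine ⟨_, hS.toFinset, rfl, ?_⟩
    intro x hx
    simp only [Set.mem_iUnion]
    exact ⟨x, by simpa using hx, by simp, by linarith⟩
  exact Nat.sInf_mem hne

lemma flo_card (δ : ℝ) (hδ : 0 < δ) (A : Finset ℝ)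
    (hsep : ∀ x ∈ A, ∀ y ∈ A, x ≠ y → δ ≤ |x - y|) : (flo δ A).card = A.card := by
  apply Finset.card_image_of_injOn
  intro x hx y hy hxy
  by_contra hne
  have h1 := hsep x hx y hy hne
  have h2 := Int.abs_sub_lt_one_of_floor_eq_floor hxy
  rw [← sub_div, abs_div, abs_of_pos hδ, div_lt_one hδ] at h2
  linarith

lemma flo_cover_card (δ : ℝ) (hδ : 0 < δ) (W : Finset ℤ) (t : Finset ℝ)
    (h : ∀ w ∈ W, ∃ x ∈ t, x / δ - 2 < w ∧ (w : ℝ) < x / δ + 2) : W.card ≤ 4 * t.card := by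
  have hsub : W ⊆ (t ×ˢ (Finset.Icc (-1 : ℤ) 2)).image (fun p => ⌊p.1 / δ⌋ + p.2) := by
    intro w hw
    obtain ⟨x, hx, h1, h2⟩ := h w hw
    rw [Finset.mem_image]
    refine ⟨(x, w - ⌊x / δ⌋), ?_, by simp⟩
    rw [Finset.mem_product, Finset.mem_Icc]
    have h3 := Int.floor_le (x / δ)
    have h4 := Int.lt_floor_add_one (x / δ)
    refine ⟨hx, ?_, ?_⟩
    · have : ((⌊x / δ⌋ - 2 : ℤ) : ℝ) < (w : ℤ) := by push_cast; linarith
      have := Int.cast_lt.1 this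
      simp only; omega
    · have : (w : ℝ) < ((⌊x / δ⌋ + 3 : ℤ) : ℝ) := by push_cast; linarith
      have := Int.cast_lt.1 this
      simp only; omega
  have h1 := (Finset.card_le_card hsub).trans Finset.card_image_le
  rw [Finset.card_product] at h1
  simp at h1
  omega

lemma nsmul_card_poly (F : Finset ℤ) (r : ℕ) : (r • F).card ≤ (r + 1) ^ F.card := by
  classical
  have key : ∀ r : ℕ, ∀ x ∈ r • F, ∃ c : F → ℕ, (∀ f, c f ≤ r) ∧ x = ∑ f : F, (c f : ℤ) * f := by
    intro r
    induction r with
    | zero =>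
      intro x hx
      refine ⟨fun _ => 0, by simp, ?_⟩
      simpa using hx
    | succ r ih =>
      intro x hx
      rw [succ_nsmul, Finset.mem_add] at hx
      obtain ⟨y, hy, f, hf, rfl⟩ := hx
      obtain ⟨c, hc, rfl⟩ := ih y hy
      refine ⟨fun g => c g + if g = ⟨f, hf⟩ then 1 else 0, ?_, ?_⟩
      · intro g
        have := hc g
        dsimp only
        split_ifs <;> omega
      · simp [add_mul, Finset.sum_add_distrib]
  have hsub : r • F ⊆ (Fintype.piFinset (fun _ : F => Finset.range (r + 1))).image
      (fun c => ∑ f : F, (c f : ℤ) * f) := by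
    intro x hx
    obtain ⟨c, hc, rfl⟩ := key r x hx
    rw [Finset.mem_image]
    exact ⟨c, by simpa [Nat.lt_succ_iff] using hc, rfl⟩
  refine (Finset.card_le_card hsub).trans (Finset.card_image_le.trans ?_)
  simp

lemma energy_growth (L : ℝ) (hL : 1 ≤ L) : ∃ C0 : ℕ, 1 ≤ C0 ∧ ∀ (δ : ℝ), 0 < δ → ∀ A : Finset ℝ,
    A.Nonempty → (∀ x ∈ A, ∀ y ∈ A, x ≠ y → δ ≤ |x - y|) →
    ((coveringNumber δ ((A : Set ℝ) + (A : Set ℝ)) : ℝ) ≤ L * (A.card : ℝ) ∨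
        (coveringNumber δ ((A : Set ℝ) - (A : Set ℝ)) : ℝ) ≤ L * (A.card : ℝ)) →
    ∀ R : ℕ, 1 ≤ R → ((flo δ A + R • (flo δ A - flo δ A)).card : ℝ) ≤
      C0 * (R : ℝ) ^ C0 * A.card := by
  refine ⟨⌈(4 * L) ^ 5⌉₊, ?_, ?_⟩
  · apply Nat.one_le_iff_ne_zero.2
    apply Nat.ne_of_gt
    apply Nat.ceil_pos.2; positivity
  intro δ hδ A hA hsep hcov R hR
  set C0 := ⌈(4 * L) ^ 5⌉₊ with hC0
  have hC0le : (4 * L) ^ 5 ≤ (C0 : ℝ) := Nat.le_ceil _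
  set Z := flo δ A with hZ
  have hZc : Z.card = A.card := flo_card δ hδ A hsep
  have hZne : Z.Nonempty := hA.image _
  have hZpos : (0 : ℝ) < Z.card := by exact_mod_cast hZne.card_pos
  -- doubling or difference
  have hPl : ∀ a b : ℕ, a + b ≤ 5 → ((a • Z - b • Z).card : ℝ) ≤ (4 * L) ^ 5 * Z.card := by
    have conv : ∀ q : ℚ≥0, (q : ℝ) ≤ 4 * L → ∀ a b : ℕ, a + b ≤ 5 →
        ((a • Z - b • Z).card : ℚ≥0) ≤ q ^ (a + b) * Z.card →
        ((a • Z - b • Z).card : ℝ) ≤ (4 * L) ^ 5 * Z.card := by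
      intro q hq a b hab h
      have h' : ((a • Z - b • Z).card : ℝ) ≤ (q : ℝ) ^ (a + b) * Z.card := by
        exact_mod_cast h
      refine h'.trans ?_
      gcongr
      calc (q : ℝ) ^ (a + b) ≤ (4 * L) ^ (a + b) := by gcongr
        _ ≤ (4 * L) ^ 5 := pow_le_pow_right₀ (by linarith) hab
    have fin1 : ((A : Set ℝ) + (A : Set ℝ)).Finite := A.finite_toSet.add A.finite_toSet
    have fin2 : ((A : Set ℝ) - (A : Set ℝ)).Finite := A.finite_toSet.sub A.finite_toSet
    intro a b hab
    rcases hcov with hcov | hcov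
    · obtain ⟨t, ht, hts⟩ := covering_attained δ hδ _ fin1
      have hc : (Z + Z).card ≤ 4 * t.card := by
        apply flo_cover_card δ hδ
        intro w hw
        rw [Finset.mem_add] at hw
        obtain ⟨_, h1, _, h2, rfl⟩ := hw
        rw [hZ, flo, Finset.mem_image] at h1 h2
        obtain ⟨a1, ha1, rfl⟩ := h1
        obtain ⟨a2, ha2, rfl⟩ := h2
        have := hts (Set.add_mem_add (Finset.mem_coe.2 ha1) (Finset.mem_coe.2 ha2))
        simp only [Set.mem_iUnion, Set.mem_Icc] at this
        obtain ⟨x, hx, h3, h4⟩ := this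
        refine ⟨x, hx, ?_⟩
        have h5 : x / δ ≤ a1 / δ + a2 / δ := by rw [← add_div]; gcongr
        have h6 : a1 / δ + a2 / δ ≤ x / δ + 1 := by
          rw [← add_div, ← div_self hδ.ne', ← add_div]; gcongr
        have := Int.floor_le (a1 / δ)
        have := Int.floor_le (a2 / δ)
        have := Int.lt_floor_add_one (a1 / δ)
        have := Int.lt_floor_add_one (a2 / δ)
        push_cast
        constructor <;> linarith
      have hc' : ((Z + Z).card : ℝ) ≤ 4 * t.card := by exact_mod_cast hc
      apply conv (((Z + Z).card : ℚ≥0) / Z.card) _ a b hab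
      · exact Finset.pluennecke_ruzsa_inequality_nsmul_sub_nsmul_add hZne Z a b
      · push_cast
        rw [div_le_iff₀ hZpos]
        rw [← ht, ← hZc] at hcov
        linarith
    · obtain ⟨t, ht, hts⟩ := covering_attained δ hδ _ fin2
      have hc : (Z - Z).card ≤ 4 * t.card := by
        apply flo_cover_card δ hδ
        intro w hw
        rw [Finset.mem_sub] at hw
        obtain ⟨_, h1, _, h2, rfl⟩ := hw
        rw [hZ, flo, Finset.mem_image] at h1 h2
        obtain ⟨a1, ha1, rfl⟩ := h1
        obtain ⟨a2, ha2, rfl⟩ := h2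
        have := hts (Set.sub_mem_sub (Finset.mem_coe.2 ha1) (Finset.mem_coe.2 ha2))
        simp only [Set.mem_iUnion, Set.mem_Icc] at this
        obtain ⟨x, hx, h3, h4⟩ := this
        refine ⟨x, hx, ?_⟩
        have h5 : x / δ ≤ a1 / δ - a2 / δ := by rw [← sub_div]; gcongr
        have h6 : a1 / δ - a2 / δ ≤ x / δ + 1 := by
          rw [← sub_div, ← div_self hδ.ne', ← add_div]; gcongr
        have := Int.floor_le (a1 / δ)
        have := Int.floor_le (a2 / δ)
        have := Int.lt_floor_add_one (a1 / δ)
        have := Int.lt_floor_add_one (a2 / δ)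
        push_cast
        constructor <;> linarith
      have hc' : ((Z - Z).card : ℝ) ≤ 4 * t.card := by exact_mod_cast hc
      apply conv (((Z - Z).card : ℚ≥0) / Z.card) _ a b hab
      · exact Finset.pluennecke_ruzsa_inequality_nsmul_sub_nsmul_sub hZne Z a b
      · push_cast
        rw [div_le_iff₀ hZpos]
        rw [← ht, ← hZc] at hcov
        linarith
  set G := Z - Z with hG
  have hGGZ : G + G + Z = 3 • Z - 2 • Z := by
    simp only [hG, sub_eq_add_neg, succ_nsmul, zero_nsmul, zero_add, neg_add]
    generalize -Z = N
    ac_rfl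
  have hZG : Z + G = 2 • Z - 1 • Z := by
    simp only [hG, sub_eq_add_neg, succ_nsmul, zero_nsmul, zero_add]
    generalize -Z = N
    ac_rfl
  have h1 : ((G + G + Z).card : ℝ) ≤ (4 * L) ^ 5 * Z.card := by
    rw [hGGZ]; exact hPl 3 2 (by norm_num)
  have h2 : ((Z + G).card : ℝ) ≤ (4 * L) ^ 5 * Z.card := by
    rw [hZG]; exact hPl 2 1 (by norm_num)
  obtain ⟨F, hF, hFc, hcovF⟩ := Finset.ruzsa_covering_add hZne h1
  rw [← hG] at hcovF
  have hind : ∀ r : ℕ, (r + 1) • G ⊆ r • F + G := by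
    intro r
    induction r with
    | zero => simp
    | succ r ih =>
      calc (r + 1 + 1) • G = (r + 1) • G + G := succ_nsmul _ _
        _ ⊆ (r • F + G) + G := Finset.add_subset_add_right ih
        _ = r • F + (G + G) := add_assoc _ _ _
        _ ⊆ r • F + (F + G) := Finset.add_subset_add_left hcovF
        _ = (r + 1) • F + G := by rw [succ_nsmul, add_assoc]
  obtain ⟨r, rfl⟩ : ∃ r, R = r + 1 := ⟨R - 1, by omega⟩
  have h3 : Z + (r + 1) • G ⊆ r • F + (Z + G) := by
    calc Z + (r + 1) • G ⊆ Z + (r • F + G) := Finset.add_subset_add_left (hind r)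
      _ = r • F + (Z + G) := by rw [add_left_comm]
  have h4 : (Z + (r + 1) • G).card ≤ (r + 1) ^ F.card * (Z + G).card :=
    (Finset.card_le_card h3).trans (Finset.card_add_le.trans
      (Nat.mul_le_mul_right _ (nsmul_card_poly F r)))
  have h5 : F.card ≤ C0 := by
    have : (F.card : ℝ) ≤ C0 := hFc.trans hC0le
    exact_mod_cast this
  have h4' : ((Z + (r + 1) • G).card : ℝ) ≤ ((r : ℝ) + 1) ^ F.card * (Z + G).card := by
    exact_mod_cast h4
  rw [← hZc]
  calc ((Z + (r + 1) • G).card : ℝ) ≤ ((r : ℝ) + 1) ^ F.card * (Z + G).card := h4'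
    _ ≤ ((r : ℝ) + 1) ^ C0 * (C0 * Z.card) := by
      gcongr
      · have : (0 : ℝ) ≤ r := by positivity
        linarith
      · exact h2.trans (by gcongr)
    _ = _ := by push_cast; ring

/-- the scales -/
noncomputable def rr (m : ℝ) (i : ℕ) : ℝ := 4 / m ^ i

lemma rr_zero (m : ℝ) : rr m 0 = 4 := by simp [rr]

lemma rr_pos (m : ℝ) (hm : 1 ≤ m) (i : ℕ) : 0 < rr m i := by
  unfold rr; positivity

lemma rr_succ (m : ℝ) (hm : 1 ≤ m) (i : ℕ) : rr m (i + 1) * m = rr m i := by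
  have : m ≠ 0 := by linarith
  unfold rr; rw [pow_succ]; field_simp

lemma rr_anti (m : ℝ) (hm : 1 ≤ m) {i j : ℕ} (h : i ≤ j) : rr m j ≤ rr m i := by
  unfold rr
  have : m ^ i ≤ m ^ j := pow_le_pow_right₀ hm h
  have : 0 < m ^ i := by positivity
  gcongr

lemma rr_add (m : ℝ) (hm : 1 ≤ m) (i j : ℕ) : rr m i * rr m j = 4 * rr m (i + j) := by
  unfold rr
  have : m ≠ 0 := by linarith
  rw [pow_add]; field_simp

/-- the number of pairs with slope close to `x` -/
noncomputable def cntP (A : Finset ℝ) (x r : ℝ) : ℕ :=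
  ((A ×ˢ A).filter (fun q => |q.1 / q.2 - x| ≤ r)).card

/-- differences -/
def InV (A : Finset ℝ) (y : ℝ) : Prop := ∃ a ∈ A, ∃ b ∈ A, y = a - b

open Classical in
/-- active scales -/
noncomputable def Uset (A : Finset ℝ) (m : ℝ) (n : ℕ) (x : ℝ) : Finset ℕ :=
  (Finset.range n).filter (fun w => ∃ α β, InV A α ∧ InV A β ∧
    rr m (w + 1) < |α - x * β| ∧ |α - x * β| ≤ rr m w)

open Classical in
/-- tangential scales -/
noncomputable def TT (A : Finset ℝ) (m : ℝ) (x : ℝ) (z : ℕ) : Finset ℕ :=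
  (Finset.range z).filter (fun t => ∃ α β, InV A α ∧ InV A β ∧
    rr m (t + 1) < |β| ∧ |β| ≤ rr m t ∧ |α - x * β| ≤ rr m z)

/-- scales at which the slope measure branches strongly -/
noncomputable def UsSet (A : Finset ℝ) (m η : ℝ) (n : ℕ) (x : ℝ) : Finset ℕ :=
  (Finset.range n).filter (fun u => (cntP A x (rr m (u + 1)) : ℝ) ≤ η * cntP A x (rr m u))

lemma mem_Uset (A : Finset ℝ) (m : ℝ) (n : ℕ) (x : ℝ) (w : ℕ) :
    w ∈ Uset A m n x ↔ w < n ∧ ∃ α β, InV A α ∧ InV A β ∧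
    rr m (w + 1) < |α - x * β| ∧ |α - x * β| ≤ rr m w := by
  classical
  simp only [Uset, Finset.mem_filter, Finset.mem_range]

lemma mem_TT (A : Finset ℝ) (m : ℝ) (x : ℝ) (z t : ℕ) :
    t ∈ TT A m x z ↔ t < z ∧ ∃ α β, InV A α ∧ InV A β ∧
    rr m (t + 1) < |β| ∧ |β| ≤ rr m t ∧ |α - x * β| ≤ rr m z := by
  classical
  simp only [TT, Finset.mem_filter, Finset.mem_range]

lemma split_aux (m : ℝ) (hm : 1 ≤ m) (T : Finset ℕ) (S : Finset ℝ)
    (hd0 : ∀ b1 ∈ S, ∀ b2 ∈ S, |b1 - b2| ≤ rr m 0) (w : ℕ) :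
    (∀ b1 ∈ S, ∀ b2 ∈ S, ∀ j < w, rr m (j + 1) < |b1 - b2| → |b1 - b2| ≤ rr m j → j ∈ T) →
    ∀ M : ℝ, 0 ≤ M →
    (∀ S' ⊆ S, (∀ b1 ∈ S', ∀ b2 ∈ S', |b1 - b2| ≤ rr m w) → (S'.card : ℝ) ≤ M) →
    (S.card : ℝ) ≤ (m + 1) ^ (T.filter (fun t => t < w)).card * M := by
  induction w with
  | zero =>
    intro _ M hM h
    simpa using h S (Finset.Subset.refl _) hd0
  | succ w ih =>
    intro hT M hM h
    have hT' : ∀ b1 ∈ S, ∀ b2 ∈ S, ∀ j < w, rr m (j + 1) < |b1 - b2| → |b1 - b2| ≤ rr m j → j ∈ T :=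
      fun b1 h1 b2 h2 j hj => hT b1 h1 b2 h2 j (by omega)
    by_cases hw : w ∈ T
    · have hcard : (T.filter (fun t => t < w + 1)).card = (T.filter (fun t => t < w)).card + 1 := by
        have : T.filter (fun t => t < w + 1) = insert w (T.filter (fun t => t < w)) := by
          ext t; simp only [Finset.mem_filter, Finset.mem_insert]
          constructor
          · rintro ⟨h1, h2⟩
            by_cases h3 : t = w
            · left; exact h3
            · right; exact ⟨h1, by omega⟩
          · rintro (rfl | ⟨h1, h2⟩)
            · exact ⟨hw, by omega⟩
            · exact ⟨h1, by omega⟩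
        rw [this, Finset.card_insert_of_notMem (by simp)]
      rw [hcard, pow_succ, mul_assoc]
      apply ih hT' _ (by positivity)
      intro S' hS' hS'd
      rcases S'.eq_empty_or_nonempty with rfl | hne
      · simp; positivity
      set b0 := S'.min' hne
      have hb0 : b0 ∈ S' := Finset.min'_mem _ _
      have hb0le : ∀ b ∈ S', b0 ≤ b := fun b hb => Finset.min'_le _ _ hb
      have hrpos := rr_pos m hm (w + 1)
      have hrs := rr_succ m hm w
      set f : ℝ → ℕ := fun b => ⌊(b - b0) / rr m (w + 1)⌋₊ with hf
      have hmaps : ∀ b ∈ S', f b ∈ Finset.range (⌊m⌋₊ + 1) := by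
        intro b hb
        rw [Finset.mem_range, Nat.lt_succ_iff]
        apply Nat.floor_le_floor
        rw [div_le_iff₀ hrpos]
        have := hS'd b hb b0 hb0
        have := le_abs_self (b - b0)
        linarith
      have hsum := Finset.card_eq_sum_card_fiberwise hmaps
      have hfib : ∀ j ∈ Finset.range (⌊m⌋₊ + 1), ((S'.filter (fun b => f b = j)).card : ℝ) ≤ M := by
        intro j _
        apply h _ ((Finset.filter_subset _ _).trans hS')
        intro b1 h1 b2 h2
        rw [Finset.mem_filter] at h1 h2
        have hh : ∀ b ∈ S', f b = j → j * rr m (w + 1) ≤ b - b0 ∧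
            b - b0 < (j + 1) * rr m (w + 1) := by
          intro b hb hbj
          have hnn : 0 ≤ (b - b0) / rr m (w + 1) :=
            div_nonneg (by linarith [hb0le b hb]) hrpos.le
          have h3 := Nat.floor_le hnn
          have h4 := Nat.lt_floor_add_one ((b - b0) / rr m (w + 1))
          have h5 : ⌊(b - b0) / rr m (w + 1)⌋₊ = j := hbj
          rw [h5] at h3 h4
          rw [le_div_iff₀ hrpos] at h3
          rw [div_lt_iff₀ hrpos] at h4
          exact ⟨h3, h4⟩
        obtain ⟨x1, x2⟩ := hh b1 h1.1 h1.2
        obtain ⟨y1, y2⟩ := hh b2 h2.1 h2.2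
        rw [abs_le]; constructor <;> linarith
      have hsum' : (S'.card : ℝ) = ∑ j ∈ Finset.range (⌊m⌋₊ + 1),
          ((S'.filter (fun b => f b = j)).card : ℝ) := by
        rw [hsum]; push_cast; rfl
      rw [hsum']
      calc _ ≤ ∑ j ∈ Finset.range (⌊m⌋₊ + 1), M := Finset.sum_le_sum hfib
        _ = ((⌊m⌋₊ : ℝ) + 1) * M := by simp
        _ ≤ (m + 1) * M := by
          gcongr
          exact Nat.floor_le (by linarith)
    · have hcard : T.filter (fun t => t < w + 1) = T.filter (fun t => t < w) := by
        ext t; simp only [Finset.mem_filter]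
        constructor
        · rintro ⟨h1, h2⟩
          refine ⟨h1, ?_⟩
          have : t ≠ w := fun e => hw (e ▸ h1)
          omega
        · rintro ⟨h1, h2⟩; exact ⟨h1, by omega⟩
      rw [hcard]
      apply ih hT' M hM
      intro S' hS' hS'd
      apply h S' hS'
      intro b1 h1 b2 h2
      by_contra hlt
      push Not at hlt
      exact hw (hT b1 (hS' h1) b2 (hS' h2) w (by omega) hlt (hS'd b1 h1 b2 h2))

lemma slope_bd (A : Finset ℝ) (hA : (A : Set ℝ) ⊆ Set.Icc 1 2) (x r : ℝ) (q : ℝ × ℝ)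
    (hq : q ∈ A ×ˢ A) (h : |q.1 / q.2 - x| ≤ r) : |q.1 - x * q.2| ≤ 2 * r := by
  rw [Finset.mem_product] at hq
  have h2 := hA hq.2
  have h3 : q.1 - x * q.2 = (q.1 / q.2 - x) * q.2 := by
    have : q.2 ≠ 0 := by have := h2.1; intro h; linarith
    field_simp
  rw [h3, abs_mul, abs_of_nonneg (by linarith [h2.1] : 0 ≤ q.2)]
  have := abs_nonneg (q.1 / q.2 - x)
  nlinarith [h2.1, h2.2]

lemma cnt_le_B (A : Finset ℝ) (hA : (A : Set ℝ) ⊆ Set.Icc 1 2) (x r M : ℝ)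
    (hM : ∀ b ∈ A, ((A.filter (fun a => |a - x * b| ≤ 2 * r)).card : ℝ) ≤ M) :
    (cntP A x r : ℝ) ≤ (A.filter (fun b => ∃ a ∈ A, |a - x * b| ≤ 2 * r)).card * M := by
  unfold cntP
  set B := A.filter (fun b => ∃ a ∈ A, |a - x * b| ≤ 2 * r) with hB
  set Q := (A ×ˢ A).filter (fun q => |q.1 / q.2 - x| ≤ r) with hQ
  have hmaps : ∀ q ∈ Q, q.2 ∈ B := by
    intro q hq
    rw [hQ, Finset.mem_filter] at hq
    have hq1 := Finset.mem_product.1 hq.1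
    rw [hB, Finset.mem_filter]
    exact ⟨hq1.2, q.1, hq1.1, slope_bd A hA x r q hq.1 hq.2⟩
  have hsum := Finset.card_eq_sum_card_fiberwise hmaps
  rw [hsum]; push_cast
  rw [← nsmul_eq_mul, ← Finset.sum_const]
  apply Finset.sum_le_sum
  intro b hb
  have hbA : b ∈ A := (Finset.mem_filter.1 hb).1
  refine le_trans ?_ (hM b hbA)
  norm_cast
  apply Finset.card_le_card_of_injOn (fun q => q.1)
  · intro q hq
    rw [Finset.mem_coe, Finset.mem_filter, hQ, Finset.mem_filter] at hq
    rw [Finset.mem_coe, Finset.mem_filter]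
    obtain ⟨⟨h1, h2⟩, h3⟩ := hq
    have := slope_bd A hA x r q h1 h2
    rw [h3] at this
    exact ⟨(Finset.mem_product.1 h1).1, this⟩
  · intro q hq q' hq' e
    have h1 := (Finset.mem_filter.1 hq).2
    have h2 := (Finset.mem_filter.1 hq').2
    exact Prod.ext e (h1.trans h2.symm)

lemma rr_rpow (m σ : ℝ) (hm : 1 ≤ m) (hσ0 : 0 < σ) (hσ1 : σ < 1) (z : ℕ) :
    (rr m z) ^ σ ≤ 4 * m ^ (-(σ * z)) ∧ (2 * rr m z) ^ σ ≤ 8 * m ^ (-(σ * z)) := by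
  have hm0 : 0 < m := by linarith
  have e : ∀ c : ℝ, 1 ≤ c → (c / m ^ z) ^ σ ≤ c * m ^ (-(σ * z)) := by
    intro c hc
    rw [Real.div_rpow (by linarith) (by positivity), div_eq_mul_inv, ← Real.rpow_natCast m z,
      ← Real.rpow_mul hm0.le, ← Real.rpow_neg hm0.le, mul_comm σ]
    gcongr
    calc c ^ σ ≤ c ^ (1 : ℝ) := Real.rpow_le_rpow_of_exponent_le hc hσ1.le
      _ = c := Real.rpow_one c
  constructor
  · exact e 4 (by norm_num)
  · have := e 8 (by norm_num)
    rwa [show 2 * rr m z = 8 / m ^ z by unfold rr; ring]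

lemma part3a (A : Finset ℝ) (hA : (A : Set ℝ) ⊆ Set.Icc 1 2) (σ δ K m x : ℝ) (hσ0 : 0 < σ)
    (hσ1 : σ < 1) (hK : 1 ≤ K) (hδ : 0 < δ)
    (hF : ∀ (x r : ℝ), δ ≤ r →
      ((A.filter (fun a => |a - x| ≤ r)).card : ℝ) ≤ K * r ^ σ * (A.card : ℝ))
    (z n : ℕ) (hz : z ≤ n) (hm : 8 * K ≤ m) (hz2 : δ ≤ rr m n) :
    (cntP A x (rr m z) : ℝ) ≤ (A.card : ℝ) ^ 2 * m ^ (1 - σ * z) := by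
  have hm1 : 1 ≤ m := by linarith
  have hrz := rr_anti m hm1 hz
  have hrp := rr_pos m hm1 z
  have h1 := cnt_le_B A hA x (rr m z) _ (fun b _ => hF (x * b) (2 * rr m z) (by linarith))
  have h2 := (rr_rpow m σ hm1 hσ0 hσ1 z).2
  have h3 : ((A.filter (fun b => ∃ a ∈ A, |a - x * b| ≤ 2 * rr m z)).card : ℝ) ≤ A.card := by
    exact_mod_cast Finset.card_filter_le _ _
  have hm0 : 0 < m := by linarith
  calc (cntP A x (rr m z) : ℝ) ≤ _ := h1
    _ ≤ A.card * (K * (8 * m ^ (-(σ * z))) * A.card) := by gcongr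
    _ = (A.card : ℝ) ^ 2 * ((8 * K) * m ^ (-(σ * z))) := by ring
    _ ≤ (A.card : ℝ) ^ 2 * (m * m ^ (-(σ * z))) := by gcongr
    _ = _ := by
      rw [sub_eq_add_neg, Real.rpow_add hm0, Real.rpow_one]

lemma part3b (A : Finset ℝ) (hA : (A : Set ℝ) ⊆ Set.Icc 1 2) (σ δ K m x : ℝ) (hσ0 : 0 < σ)
    (hσ1 : σ < 1) (hK : 1 ≤ K) (hδ : 0 < δ)
    (hF : ∀ (x r : ℝ), δ ≤ r →
      ((A.filter (fun a => |a - x| ≤ r)).card : ℝ) ≤ K * r ^ σ * (A.card : ℝ))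
    (z n : ℕ) (hz : z + 1 ≤ n) (hm : 32 * K ^ 2 * 2 ^ n ≤ m) (hz2 : δ ≤ rr m n) :
    (cntP A x (rr m (z + 1)) : ℝ) ≤
      (A.card : ℝ) ^ 2 * m ^ ((TT A m x z).card + 2 - 2 * σ * (z + 1)) := by
  have hp2 : (1 : ℝ) ≤ 2 ^ n := one_le_pow₀ (by norm_num)
  have hm32 : 32 ≤ m := by nlinarith
  have hm1 : 1 ≤ m := by linarith
  have hm0 : 0 < m := by linarith
  have hrz := rr_anti m hm1 hz
  have hrp := rr_pos m hm1 (z + 1)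
  have hrs := rr_succ m hm1 z
  have h1 := cnt_le_B A hA x (rr m (z + 1)) _ (fun b _ => hF (x * b) (2 * rr m (z + 1)) (by linarith))
  have h2 := (rr_rpow m σ hm1 hσ0 hσ1 (z + 1)).2
  have h2' := (rr_rpow m σ hm1 hσ0 hσ1 z).1
  set B := A.filter (fun b => ∃ a ∈ A, |a - x * b| ≤ 2 * rr m (z + 1)) with hB
  have hBA : B ⊆ A := Finset.filter_subset _ _
  have hdiam : ∀ b1 ∈ B, ∀ b2 ∈ B, |b1 - b2| ≤ rr m 0 := by
    intro b1 hb1 b2 hb2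
    have e1 := hA (hBA hb1)
    have e2 := hA (hBA hb2)
    rw [rr_zero, abs_le]
    constructor <;> linarith [e1.1, e1.2, e2.1, e2.2]
  have hBc := split_aux m hm1 (TT A m x z) B hdiam z (by
    intro b1 hb1 b2 hb2 j hj h3 h4
    obtain ⟨hb1A, a1, ha1, h5⟩ := Finset.mem_filter.1 hb1
    obtain ⟨hb2A, a2, ha2, h6⟩ := Finset.mem_filter.1 hb2
    rw [mem_TT]
    refine ⟨hj, a1 - a2, b1 - b2, ⟨a1, ha1, a2, ha2, rfl⟩, ⟨b1, hb1A, b2, hb2A, rfl⟩, h3, h4, ?_⟩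
    have : a1 - a2 - x * (b1 - b2) = (a1 - x * b1) - (a2 - x * b2) := by ring
    rw [this]
    have := abs_sub (a1 - x * b1) (a2 - x * b2)
    nlinarith) (K * (rr m z) ^ σ * A.card) (by have := rr_pos m hm1 z; positivity) (by
    intro S' hS' hd
    have hrp' := rr_pos m hm1 z
    rcases S'.eq_empty_or_nonempty with rfl | ⟨b0, hb0⟩
    · simp; positivity
    refine le_trans ?_ (hF b0 (rr m z) (by nlinarith))
    norm_cast
    apply Finset.card_le_card
    intro b hb
    rw [Finset.mem_filter]
    exact ⟨hBA (hS' hb), hd b hb b0 hb0⟩)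
  set T := (TT A m x z).card with hT
  have hTn : T ≤ n := by
    have : T ≤ z := by
      have hsub : TT A m x z ⊆ Finset.range z := by
        intro t ht
        exact Finset.mem_range.2 ((mem_TT _ _ _ _ _).1 ht).1
      have := Finset.card_le_card hsub
      rwa [Finset.card_range] at this
    omega
  have h4 : (m + 1) ^ ((TT A m x z).filter (fun t => t < z)).card ≤ 2 ^ n * m ^ T := by
    calc (m + 1) ^ ((TT A m x z).filter (fun t => t < z)).card ≤ (m + 1) ^ T :=
        pow_le_pow_right₀ (by linarith) (Finset.card_filter_le _ _)
      _ ≤ (2 * m) ^ T := by gcongr; linarith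
      _ = 2 ^ T * m ^ T := mul_pow _ _ _
      _ ≤ 2 ^ n * m ^ T := by
        gcongr; norm_num
  have h5 : (m : ℝ) ^ (-(σ * (z : ℝ))) ≤ m * m ^ (-(σ * ((z + 1 : ℕ) : ℝ))) := by
    push_cast
    nth_rw 2 [← Real.rpow_one m]
    rw [← Real.rpow_add hm0]
    apply Real.rpow_le_rpow_of_exponent_le hm1
    linarith
  calc (cntP A x (rr m (z + 1)) : ℝ) ≤ _ := h1
    _ ≤ ((2 ^ n * m ^ T) * (K * (4 * (m * m ^ (-(σ * ((z + 1 : ℕ) : ℝ))))) * A.card)) *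
        (K * (8 * m ^ (-(σ * ((z + 1 : ℕ) : ℝ)))) * A.card) := by
      have hr' := rr_pos m hm1 z
      gcongr
      refine hBc.trans ?_
      gcongr
      linarith
    _ = (A.card : ℝ) ^ 2 * ((32 * K ^ 2 * 2 ^ n) * (m ^ T * m * m ^ (-(σ * ((z + 1 : ℕ) : ℝ))) *
        m ^ (-(σ * ((z + 1 : ℕ) : ℝ))))) := by ring
    _ ≤ (A.card : ℝ) ^ 2 * (m * (m ^ T * m * m ^ (-(σ * ((z + 1 : ℕ) : ℝ))) *
        m ^ (-(σ * ((z + 1 : ℕ) : ℝ))))) := by gcongr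
    _ = _ := by
      congr 1
      generalize hX : (m : ℝ) ^ (-(σ * ((z + 1 : ℕ) : ℝ))) = X
      have e : m * (m ^ T * m * X * X) = m ^ (T : ℝ) * m ^ (2 : ℝ) * X * X := by
        rw [Real.rpow_natCast, Real.rpow_two]; ring
      rw [e, ← hX, ← Real.rpow_add hm0, ← Real.rpow_add hm0, ← Real.rpow_add hm0]
      congr 1
      push_cast; ring

/-- approximate representability by a sum of `R` differences -/
def ApxRep (δ : ℝ) (Z : Finset ℤ) (R : ℕ) (y : ℝ) : Prop :=
  ∃ k ∈ R • (Z - Z), |y / δ - (k : ℝ)| ≤ R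

lemma ApxRep_add (δ : ℝ) (Z : Finset ℤ) (R R' : ℕ) (y y' : ℝ) (h : ApxRep δ Z R y) (h' : ApxRep δ Z R' y') :
    ApxRep δ Z (R + R') (y + y') := by
  obtain ⟨k, hk, e⟩ := h
  obtain ⟨k', hk', e'⟩ := h'
  refine ⟨k + k', ?_, ?_⟩
  · rw [add_nsmul]; exact Finset.add_mem_add hk hk'
  · push_cast
    have := abs_add_le (y / δ - k) (y' / δ - k')
    rw [show (y + y') / δ - ((k : ℝ) + k') = (y / δ - k) + (y' / δ - k') by ring]
    linarith

lemma ApxRep_zero (δ : ℝ) (Z : Finset ℤ) : ApxRep δ Z 0 0 := ⟨0, by simp, by simp⟩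

lemma ApxRep_one (δ : ℝ) (A : Finset ℝ) (y : ℝ) (h : InV A y) : ApxRep δ (flo δ A) 1 y := by
  obtain ⟨a, ha, b, hb, rfl⟩ := h
  refine ⟨⌊a / δ⌋ - ⌊b / δ⌋, ?_, ?_⟩
  · rw [one_nsmul]
    exact Finset.sub_mem_sub (Finset.mem_image_of_mem _ ha) (Finset.mem_image_of_mem _ hb)
  · have := Int.floor_le (a / δ)
    have := Int.floor_le (b / δ)
    have := Int.lt_floor_add_one (a / δ)
    have := Int.lt_floor_add_one (b / δ)
    rw [sub_div, abs_le]; push_cast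
    constructor <;> linarith

lemma ApxRep_nsmul (δ : ℝ) (A : Finset ℝ) (y : ℝ) (h : InV A y) (j : ℕ) :
    ApxRep δ (flo δ A) j (j * y) := by
  induction j with
  | zero => simpa using ApxRep_zero δ (flo δ A)
  | succ j ih =>
    have := ApxRep_add δ _ j 1 _ _ ih (ApxRep_one δ A y h)
    rw [show (((j + 1 : ℕ) : ℝ)) * y = j * y + y by push_cast; ring]
    exact this

lemma ApxRep_mono (δ : ℝ) (A : Finset ℝ) (hA : A.Nonempty) (R R' : ℕ) (hR : R ≤ R') (y : ℝ)
    (h : ApxRep δ (flo δ A) R y) : ApxRep δ (flo δ A) R' y := by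
  obtain ⟨a, ha⟩ := hA
  obtain ⟨d, rfl⟩ := Nat.exists_eq_add_of_le hR
  have := ApxRep_add δ _ R d _ _ h (ApxRep_nsmul δ A 0 ⟨a, ha, a, ha, by simp⟩ d)
  simpa using this

lemma fill_succ_le (U : Finset ℕ) (K w : ℕ) :
    (fillSet U K (w + 1)).card ≤ (fillSet U K w).card + 1 := by
  have : fillSet U K (w + 1) ⊆ insert w (fillSet U K w) := by
    intro t ht
    simp only [fillSet, Finset.mem_filter, Finset.mem_range, Finset.mem_insert] at ht ⊢
    by_cases h : t = w
    · left; exact h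
    · right; exact ⟨by omega, ht.2⟩
  exact (Finset.card_le_card this).trans (Finset.card_insert_le _ _)

lemma fill_succ_le' (U : Finset ℕ) (K w : ℕ) (h : ¬ ∃ u ∈ U, u ≤ w ∧ w < u + K) :
    (fillSet U K (w + 1)).card ≤ (fillSet U K w).card := by
  apply Finset.card_le_card
  intro t ht
  simp only [fillSet, Finset.mem_filter, Finset.mem_range] at ht ⊢
  refine ⟨?_, ht.2⟩
  have : t ≠ w := by
    rintro rfl
    exact h ht.2
  omega

lemma gain_ineq (m s g r r' : ℝ) (K J : ℕ) (hK : 1 ≤ K) (hm : 2 ≤ m) (hr' : 0 < r')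
    (hrr : r' * m = r) (h1 : r' < g) (h2 : g ≤ r) (h3 : r ≤ s)
    (hJ : J = min ⌊s / g⌋₊ ⌊m ^ (K + 1)⌋₊) :
    m / 2 * min (s / r) (m ^ K) ≤ J * min (g / r') (m ^ K) := by
  have hg : 0 < g := by linarith
  have hr : 0 < r := by linarith
  have hmK : m ≤ m ^ K := le_self_pow₀ (by linarith) (by omega)
  have hsg : 1 ≤ s / g := by rw [le_div_iff₀ hg]; linarith
  have half : ∀ y : ℝ, 1 ≤ y → y / 2 ≤ (⌊y⌋₊ : ℝ) := by
    intro y hy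
    have h4 := Nat.lt_floor_add_one y
    have h5 : 1 ≤ ⌊y⌋₊ := Nat.le_floor (by simpa using hy)
    have h6 : (1 : ℝ) ≤ ⌊y⌋₊ := by exact_mod_cast h5
    linarith
  have hL1 : m / 2 * min (s / r) (m ^ K) ≤ m / 2 * (s / r) := by
    gcongr; exact min_le_left _ _
  have hL2 : m / 2 * min (s / r) (m ^ K) ≤ m / 2 * m ^ K := by
    gcongr; exact min_le_right _ _
  have goal2 : m / 2 * min (s / r) (m ^ K) ≤ J * (g / r') ∧
      m / 2 * min (s / r) (m ^ K) ≤ J * m ^ K := by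
    rcases le_total ⌊s / g⌋₊ ⌊m ^ (K + 1)⌋₊ with h | h
    · rw [min_eq_left h] at hJ
      have hJ2 := half _ hsg
      rw [← hJ] at hJ2
      have hJg : s ≤ 2 * J * g := by
        rw [div_div, div_le_iff₀ (by positivity)] at hJ2
        linarith
      constructor
      · refine hL1.trans ?_
        rw [← hrr, show m / 2 * (s / (r' * m)) = (s / 2) / r' by field_simp, ← mul_div_assoc]
        gcongr
        linarith
      · refine hL1.trans ?_
        have h7 : s / r ≤ 2 * J := by
          rw [div_le_iff₀ hr]
          refine hJg.trans ?_
          gcongr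
        calc m / 2 * (s / r) ≤ m / 2 * (2 * J) := by gcongr
          _ = J * m := by ring
          _ ≤ J * m ^ K := by gcongr
    · rw [min_eq_right h] at hJ
      have hJ2 := half (m ^ (K + 1)) (one_le_pow₀ (by linarith))
      rw [← hJ] at hJ2
      have e : m / 2 * m ^ K = m ^ (K + 1) / 2 := by rw [pow_succ]; ring
      rw [e] at hL2
      have hJle : m / 2 * min (s / r) (m ^ K) ≤ J := hL2.trans hJ2
      have hJ0 : (0 : ℝ) ≤ J := by positivity
      constructor
      · refine hJle.trans (le_mul_of_one_le_right hJ0 ?_)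
        rw [le_div_iff₀ hr']; linarith
      · exact hJle.trans (le_mul_of_one_le_right hJ0 (by linarith))
  rcases min_choice (g / r') (m ^ K) with h | h
  · rw [h]; exact goal2.1
  · rw [h]; exact goal2.2

lemma construct (A : Finset ℝ) (hA : A.Nonempty) (δ x m : ℝ) (hm : 2 ≤ m) (n K : ℕ) (hK : 1 ≤ K) :
    ∀ w ≤ n, ∃ (Y : Finset (ℝ × ℝ)) (s : ℝ), rr m w ≤ s ∧
      (∀ u ∈ Uset A m n x, u < w → s ≤ rr m u) ∧
      (∀ y ∈ Y, ∀ y' ∈ Y, y ≠ y' → s ≤ |(y.1 - x * y.2) - (y'.1 - x * y'.2)|) ∧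
      (∀ y ∈ Y, ApxRep δ (flo δ A) (w * ⌊m ^ (K + 1)⌋₊) y.1 ∧
        ApxRep δ (flo δ A) (w * ⌊m ^ (K + 1)⌋₊) y.2) ∧
      m ^ (fillSet (Uset A m n x) K w).card ≤ 2 ^ w * (Y.card * min (s / rr m w) (m ^ K)) := by
  have hm1 : 1 ≤ m := by linarith
  intro w
  set Bn := ⌊m ^ (K + 1)⌋₊ with hBn
  set U := Uset A m n x with hU
  induction w with
  | zero =>
    intro _
    refine ⟨{(0, 0)}, 4, by rw [rr_zero], by simp, ?_, ?_, ?_⟩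
    · intro y hy y' hy' hne
      rw [Finset.mem_singleton] at hy hy'
      exact absurd (hy.trans hy'.symm) hne
    · intro y hy
      rw [Finset.mem_singleton] at hy
      rw [hy, Nat.zero_mul]
      exact ⟨ApxRep_zero _ _, ApxRep_zero _ _⟩
    · have : (1 : ℝ) ≤ m ^ K := one_le_pow₀ hm1
      simp [fillSet, rr_zero, this]
  | succ w ih =>
    intro hw
    obtain ⟨Y, s, hs1, hs2, hsep, hrep, hcard⟩ := ih (by omega)
    have hrp := rr_pos m hm1 w
    have hrp1 := rr_pos m hm1 (w + 1)
    have hrs := rr_succ m hm1 w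
    have hsp : 0 < s := by linarith
    have hBn1 : 1 ≤ Bn := Nat.le_floor (by simpa using one_le_pow₀ hm1)
    by_cases hwU : w ∈ U
    · -- active scale
      obtain ⟨α, β, hα, hβ, hγ1, hγ2⟩ : ∃ α β, InV A α ∧ InV A β ∧
          rr m (w + 1) < α - x * β ∧ α - x * β ≤ rr m w := by
        obtain ⟨_, α, β, hα, hβ, h1, h2⟩ := (mem_Uset _ _ _ _ _).1 hwU
        rcases le_total 0 (α - x * β) with h | h
        · rw [abs_of_nonneg h] at h1 h2
          exact ⟨α, β, hα, hβ, h1, h2⟩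
        · rw [abs_of_nonpos h] at h1 h2
          obtain ⟨a, ha, b, hb, rfl⟩ := hα
          obtain ⟨a', ha', b', hb', rfl⟩ := hβ
          refine ⟨b - a, b' - a', ⟨b, hb, a, ha, rfl⟩, ⟨b', hb', a', ha', rfl⟩, ?_, ?_⟩ <;> linarith
      set γ := α - x * β with hγ
      have hγp : 0 < γ := by linarith
      set J := min ⌊s / γ⌋₊ Bn with hJ
      have hgain := gain_ineq m s γ (rr m w) (rr m (w + 1)) K J hK hm hrp1 hrs hγ1 hγ2 hs1 hJ
      have hJs : (J : ℝ) * γ ≤ s := by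
        have h1 : (J : ℝ) ≤ ⌊s / γ⌋₊ := by exact_mod_cast min_le_left _ _
        have h2 := Nat.floor_le (by positivity : 0 ≤ s / γ)
        have h3 := h1.trans h2
        rwa [le_div_iff₀ hγp] at h3
      have hJB : J ≤ Bn := min_le_right _ _
      set f : (ℝ × ℝ) × ℕ → ℝ × ℝ := fun p => (p.1.1 + p.2 * α, p.1.2 + p.2 * β) with hf
      have hsepf : ∀ p ∈ Y ×ˢ Finset.range J, ∀ p' ∈ Y ×ˢ Finset.range J, p ≠ p' →
          γ ≤ |((f p).1 - x * (f p).2) - ((f p').1 - x * (f p').2)| := by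
        rintro ⟨y, j⟩ hp ⟨y', j'⟩ hp' hne
        rw [Finset.mem_product, Finset.mem_range] at hp hp'
        obtain ⟨hy, hj⟩ := hp
        obtain ⟨hy', hj'⟩ := hp'
        simp only at hy hy' hj hj'
        have e : ((f (y, j)).1 - x * (f (y, j)).2) - ((f (y', j')).1 - x * (f (y', j')).2) =
            ((y.1 - x * y.2) - (y'.1 - x * y'.2)) + ((j : ℝ) - j') * γ := by
          simp only [hf, hγ]; ring
        rw [e]
        by_cases hyy : y = y'
        · subst hyy
          have hjj : (j : ℤ) - j' ≠ 0 := by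
            intro h
            apply hne
            have : j = j' := by omega
            rw [this]
          have h1 : (1 : ℝ) ≤ |(j : ℝ) - j'| := by
            have := Int.one_le_abs hjj
            exact_mod_cast this
          rw [sub_self, zero_add, abs_mul, abs_of_pos hγp]
          nlinarith
        · have h1 := hsep y hy y' hy' hyy
          have h2 : |((j : ℝ) - j') * γ| ≤ (J - 1) * γ := by
            rw [abs_mul, abs_of_pos hγp]
            gcongr
            have h3 : (j : ℝ) + 1 ≤ J := by exact_mod_cast hj
            have h4 : (j' : ℝ) + 1 ≤ J := by exact_mod_cast hj'
            have h5 : (0 : ℝ) ≤ j := by positivity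
            have h6 : (0 : ℝ) ≤ j' := by positivity
            rw [abs_le]; constructor <;> linarith
          have h3 : |(y.1 - x * y.2) - (y'.1 - x * y'.2)| ≤
              |((y.1 - x * y.2) - (y'.1 - x * y'.2)) + ((j : ℝ) - j') * γ| +
              |((j : ℝ) - j') * γ| := by
            have := abs_sub (((y.1 - x * y.2) - (y'.1 - x * y'.2)) + ((j : ℝ) - j') * γ)
              (((j : ℝ) - j') * γ)
            rwa [add_sub_cancel_right] at this
          linarith
      have hinj : Set.InjOn f (Y ×ˢ Finset.range J : Finset _) := by
        intro p hp p' hp' hpp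
        by_contra hne
        have := hsepf p hp p' hp' hne
        rw [hpp, sub_self, abs_zero] at this
        linarith
      refine ⟨(Y ×ˢ Finset.range J).image f, γ, hγ1.le, ?_, ?_, ?_, ?_⟩
      · intro u hu huw
        by_cases h : u = w
        · rw [h]; exact hγ2
        · have := hs2 u hu (by omega)
          linarith
      · intro y hy y' hy' hne
        rw [Finset.mem_image] at hy hy'
        obtain ⟨p, hp, rfl⟩ := hy
        obtain ⟨p', hp', rfl⟩ := hy'
        exact hsepf p hp p' hp' (fun h => hne (by rw [h]))
      · intro y hy
        rw [Finset.mem_image] at hy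
        obtain ⟨⟨y0, j⟩, hp, rfl⟩ := hy
        rw [Finset.mem_product, Finset.mem_range] at hp
        obtain ⟨hy0, hj⟩ := hp
        simp only at hy0 hj
        have h1 := hrep y0 hy0
        have hle : w * Bn + j ≤ (w + 1) * Bn := by rw [add_mul, one_mul]; omega
        exact ⟨ApxRep_mono δ A hA _ _ hle _ (ApxRep_add _ _ _ _ _ _ h1.1 (ApxRep_nsmul δ A α hα j)),
          ApxRep_mono δ A hA _ _ hle _ (ApxRep_add _ _ _ _ _ _ h1.2 (ApxRep_nsmul δ A β hβ j))⟩
      · rw [Finset.card_image_of_injOn hinj, Finset.card_product, Finset.card_range]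
        calc m ^ (fillSet U K (w + 1)).card ≤ m ^ ((fillSet U K w).card + 1) :=
              pow_le_pow_right₀ hm1 (fill_succ_le _ _ _)
          _ = m * m ^ (fillSet U K w).card := by rw [pow_succ]; ring
          _ ≤ m * (2 ^ w * (Y.card * min (s / rr m w) (m ^ K))) := by gcongr
          _ = 2 ^ (w + 1) * (Y.card * (m / 2 * min (s / rr m w) (m ^ K))) := by
            rw [pow_succ]; ring
          _ ≤ 2 ^ (w + 1) * (Y.card * (J * min (γ / rr m (w + 1)) (m ^ K))) := by gcongr
          _ = _ := by push_cast; ring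
    · have hanti := rr_anti m hm1 (show w ≤ w + 1 by omega)
      refine ⟨Y, s, by linarith, ?_, hsep, ?_, ?_⟩
      · intro u hu huw
        apply hs2 u hu
        have : u ≠ w := fun h => hwU (h ▸ hu)
        omega
      · intro y hy
        have h1 := hrep y hy
        have hle : w * Bn ≤ (w + 1) * Bn := Nat.mul_le_mul_right _ (by omega)
        exact ⟨ApxRep_mono δ A hA _ _ hle _ h1.1, ApxRep_mono δ A hA _ _ hle _ h1.2⟩
      · have hquot : s / rr m (w + 1) = m * (s / rr m w) := by
          rw [← hrs]; field_simp
        have hq0 : 0 < s / rr m w := by positivity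
        by_cases hfill : ∃ u ∈ U, u ≤ w ∧ w < u + K
        · obtain ⟨u, hu, huw, hwu⟩ := hfill
          have hne : u ≠ w := fun h => hwU (h ▸ hu)
          have hsu := hs2 u hu (by omega)
          have hle : m * (s / rr m w) ≤ m ^ K := by
            have h1 : rr m u = rr m w * m ^ (w - u) := by
              unfold rr
              obtain ⟨d, rfl⟩ := Nat.exists_eq_add_of_le huw
              have : m ≠ 0 := by linarith
              rw [Nat.add_sub_cancel_left, pow_add]; field_simp
            have h2 : s / rr m w ≤ m ^ (w - u) := by
              rw [div_le_iff₀ hrp]; linarith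
            calc m * (s / rr m w) ≤ m * m ^ (w - u) := by gcongr
              _ = m ^ (w - u + 1) := by rw [pow_succ]; ring
              _ ≤ m ^ K := pow_le_pow_right₀ hm1 (by omega)
          rw [hquot, min_eq_left hle]
          calc m ^ (fillSet U K (w + 1)).card ≤ m ^ ((fillSet U K w).card + 1) :=
                pow_le_pow_right₀ hm1 (fill_succ_le _ _ _)
            _ = m * m ^ (fillSet U K w).card := by rw [pow_succ]; ring
            _ ≤ m * (2 ^ w * (Y.card * min (s / rr m w) (m ^ K))) := by gcongr
            _ ≤ m * (2 ^ w * (Y.card * (s / rr m w))) := by gcongr; exact min_le_left _ _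
            _ = 2 ^ w * (Y.card * (m * (s / rr m w))) := by ring
            _ ≤ 2 ^ (w + 1) * (Y.card * (m * (s / rr m w))) := by
              gcongr
              · norm_num
              · omega
        · calc m ^ (fillSet U K (w + 1)).card ≤ m ^ (fillSet U K w).card :=
                pow_le_pow_right₀ hm1 (fill_succ_le' _ _ _ hfill)
            _ ≤ (2 ^ w * (Y.card * min (s / rr m w) (m ^ K))) := hcard
            _ ≤ 2 ^ (w + 1) * (Y.card * min (s / rr m (w + 1)) (m ^ K)) := by
              gcongr
              · norm_num
              · omega

lemma omega_mem (δ : ℝ) (A : Finset ℝ) (R : ℕ) (y a : ℝ) (ha : a ∈ A)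
    (hy : ApxRep δ (flo δ A) R y) :
    ⌊(y + a) / δ⌋ ∈ (flo δ A + R • (flo δ A - flo δ A)) + Finset.Icc (-(R : ℤ)) R := by
  obtain ⟨k, hk, e⟩ := hy
  have h1 := Int.floor_le (a / δ)
  have h2 := Int.lt_floor_add_one (a / δ)
  have h3 := Int.floor_le ((y + a) / δ)
  have h4 := Int.lt_floor_add_one ((y + a) / δ)
  rw [abs_le] at e
  have e' : (y + a) / δ = y / δ + a / δ := add_div _ _ _
  rw [Finset.mem_add]
  refine ⟨⌊a / δ⌋ + k, Finset.add_mem_add (Finset.mem_image_of_mem _ ha) hk,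
    ⌊(y + a) / δ⌋ - (⌊a / δ⌋ + k), ?_, by ring⟩
  rw [Finset.mem_Icc]
  constructor
  · have : ((-(R : ℤ) - 1 : ℤ) : ℝ) < ((⌊(y + a) / δ⌋ - (⌊a / δ⌋ + k) : ℤ) : ℝ) := by
      push_cast; linarith [e.1]
    have := Int.cast_lt.1 this
    omega
  · have : ((⌊(y + a) / δ⌋ - (⌊a / δ⌋ + k) : ℤ) : ℝ) < (((R : ℤ) + 1 : ℤ) : ℝ) := by
      push_cast; linarith [e.2]
    have := Int.cast_lt.1 this
    omega

lemma count_Y (A : Finset ℝ) (hA : (A : Set ℝ) ⊆ Set.Icc 1 2) (δ : ℝ) (hδ : 0 < δ)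
    (hsep : ∀ x ∈ A, ∀ y ∈ A, x ≠ y → δ ≤ |x - y|) (x : ℝ) (hx : 1 / 2 ≤ x ∧ x ≤ 2)
    (r s : ℝ) (hr : 3 * δ ≤ r) (hs : 5 * r ≤ s) (R : ℕ) (Y : Finset (ℝ × ℝ))
    (hY : ∀ y ∈ Y, ∀ y' ∈ Y, y ≠ y' → s ≤ |(y.1 - x * y.2) - (y'.1 - x * y'.2)|)
    (hrep : ∀ y ∈ Y, ApxRep δ (flo δ A) R y.1 ∧ ApxRep δ (flo δ A) R y.2) :
    Y.card * cntP A x r ≤ (((flo δ A + R • (flo δ A - flo δ A)).card) * (2 * R + 1)) ^ 2 := by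
  set Ω := (flo δ A + R • (flo δ A - flo δ A)) + Finset.Icc (-(R : ℤ)) R with hΩ
  have hΩc : Ω.card ≤ (flo δ A + R • (flo δ A - flo δ A)).card * (2 * R + 1) := by
    refine Finset.card_add_le.trans ?_
    gcongr
    rw [Int.card_Icc]
    omega
  set Q := (A ×ˢ A).filter (fun q => |q.1 / q.2 - x| ≤ r) with hQ
  have hinj : (Y ×ˢ Q).card ≤ (Ω ×ˢ Ω).card := by
    apply Finset.card_le_card_of_injOn
      (fun p => (⌊(p.1.1 + p.2.1) / δ⌋, ⌊(p.1.2 + p.2.2) / δ⌋))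
    · rintro ⟨y, q⟩ hp
      rw [Finset.mem_coe, Finset.mem_product] at hp
      obtain ⟨hy, hq⟩ := hp
      simp only at hy hq
      have hqA := Finset.mem_product.1 (Finset.mem_filter.1 hq).1
      rw [Finset.mem_coe, Finset.mem_product]
      exact ⟨omega_mem δ A R _ _ hqA.1 (hrep y hy).1, omega_mem δ A R _ _ hqA.2 (hrep y hy).2⟩
    · rintro ⟨y, q⟩ hp ⟨y', q'⟩ hp' heq
      rw [Finset.mem_coe, Finset.mem_product] at hp hp'
      obtain ⟨hy, hq⟩ := hp
      obtain ⟨hy', hq'⟩ := hp'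
      simp only [Prod.mk.injEq] at hy hq hy' hq' heq
      have habs : ∀ u v : ℝ, ⌊u / δ⌋ = ⌊v / δ⌋ → |u - v| < δ := by
        intro u v huv
        have h2 := Int.abs_sub_lt_one_of_floor_eq_floor huv
        rwa [← sub_div, abs_div, abs_of_pos hδ, div_lt_one hδ] at h2
      have e1 := habs _ _ heq.1
      have e2 := habs _ _ heq.2
      obtain ⟨hqP, hqx⟩ := Finset.mem_filter.1 hq
      obtain ⟨hqP', hqx'⟩ := Finset.mem_filter.1 hq'
      have b1 := slope_bd A hA x r q hqP hqx
      have b2 := slope_bd A hA x r q' hqP' hqx'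
      have hyy : y = y' := by
        by_contra hne
        have h1 := hY y hy y' hy' hne
        have h2 : (y.1 - x * y.2) - (y'.1 - x * y'.2) =
            ((y.1 + q.1) - (y'.1 + q'.1)) - x * ((y.2 + q.2) - (y'.2 + q'.2))
            - (q.1 - x * q.2) + (q'.1 - x * q'.2) := by ring
        rw [h2] at h1
        rw [abs_lt] at e1 e2
        rw [abs_le] at b1 b2
        have h3 : |x * ((y.2 + q.2) - (y'.2 + q'.2))| < 2 * δ := by
          rw [abs_mul, abs_of_nonneg (by linarith [hx.1] : 0 ≤ x)]
          have : |(y.2 + q.2) - (y'.2 + q'.2)| < δ := by rw [abs_lt]; exact e2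
          nlinarith [hx.1, hx.2, abs_nonneg ((y.2 + q.2) - (y'.2 + q'.2))]
        rw [abs_lt] at h3
        have h4 : |((y.1 + q.1) - (y'.1 + q'.1)) - x * ((y.2 + q.2) - (y'.2 + q'.2))
            - (q.1 - x * q.2) + (q'.1 - x * q'.2)| < s := by
          rw [abs_lt]; constructor <;> linarith [e1.1, e1.2, h3.1, h3.2, b1.1, b1.2, b2.1, b2.2]
        linarith
      subst hyy
      have hqA := Finset.mem_product.1 hqP
      have hqA' := Finset.mem_product.1 hqP'
      rw [show y.1 + q.1 - (y.1 + q'.1) = q.1 - q'.1 by ring] at e1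
      rw [show y.2 + q.2 - (y.2 + q'.2) = q.2 - q'.2 by ring] at e2
      have c1 : q.1 = q'.1 := by
        by_contra hne
        have := hsep _ hqA.1 _ hqA'.1 hne
        linarith
      have c2 : q.2 = q'.2 := by
        by_contra hne
        have := hsep _ hqA.2 _ hqA'.2 hne
        linarith
      rw [Prod.ext c1 c2]
  rw [Finset.card_product, Finset.card_product] at hinj
  calc Y.card * cntP A x r ≤ Ω.card * Ω.card := hinj
    _ ≤ _ := by rw [sq]; exact Nat.mul_le_mul hΩc hΩc

lemma part2 (A : Finset ℝ) (hne : A.Nonempty) (hA : (A : Set ℝ) ⊆ Set.Icc 1 2) (δ : ℝ) (hδ : 0 < δ)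
    (hsep : ∀ x ∈ A, ∀ y ∈ A, x ≠ y → δ ≤ |x - y|) (x : ℝ) (hx : 1 / 2 ≤ x ∧ x ≤ 2)
    (C0 : ℕ) (hgrow : ∀ R : ℕ, 1 ≤ R → ((flo δ A + R • (flo δ A - flo δ A)).card : ℝ) ≤
      C0 * (R : ℝ) ^ C0 * A.card) (m : ℝ) (n : ℕ) (hm5 : 5 ≤ m) (hn : 1 ≤ n)
    (hm : 9 * (C0 : ℝ) ^ 2 * (n : ℝ) ^ (2 * C0 + 2) * 2 ^ n ≤ m)
    (hδn : 3 * δ ≤ rr m n) (K : ℕ) (hK : 1 ≤ K) (z : ℕ) (hz : z ≤ n) :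
    (cntP A x (rr m z) : ℝ) * m ^ (fillSet (Uset A m n x) K z).card ≤
      (A.card : ℝ) ^ 2 * m ^ ((2 * C0 + 2) * (K + 1) + K + 2) := by
  have hm1 : 1 ≤ m := by linarith
  have hm0 : 0 < m := by linarith
  rcases z with _ | z
  · have h1 : (cntP A x (rr m 0) : ℝ) ≤ (A.card : ℝ) ^ 2 := by
      have : cntP A x (rr m 0) ≤ A.card ^ 2 := by
        refine (Finset.card_filter_le _ _).trans ?_
        rw [Finset.card_product, sq]
      exact_mod_cast this
    have h2 : (1 : ℝ) ≤ m ^ ((2 * C0 + 2) * (K + 1) + K + 2) := one_le_pow₀ hm1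
    have h3 : (fillSet (Uset A m n x) K 0).card = 0 := by simp [fillSet]
    rw [h3, pow_zero, mul_one]
    refine h1.trans (le_mul_of_one_le_right (by positivity) h2)
  obtain ⟨Y, s, hs1, -, hYsep, hYrep, hYc⟩ := construct A hne δ x m (by linarith) n K hK z (by omega)
  set Bn := ⌊m ^ (K + 1)⌋₊ with hBn
  have hBn1 : 1 ≤ Bn := Nat.le_floor (by simpa using one_le_pow₀ hm1)
  have hBnle : (Bn : ℝ) ≤ m ^ (K + 1) := Nat.floor_le (by positivity)
  set R := n * Bn with hR
  have hR1 : 1 ≤ R := Nat.mul_pos hn hBn1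
  have hrs := rr_succ m hm1 z
  have hrp := rr_pos m hm1 (z + 1)
  have hcount := count_Y A hA δ hδ hsep x hx (rr m (z + 1)) s
    (hδn.trans (rr_anti m hm1 hz)) (by nlinarith) R Y hYsep (by
      intro y hy
      have hle : z * Bn ≤ n * Bn := Nat.mul_le_mul_right _ (by omega)
      exact ⟨ApxRep_mono δ A hne _ _ hle _ (hYrep y hy).1, ApxRep_mono δ A hne _ _ hle _ (hYrep y hy).2⟩)
  have hcount' : (Y.card : ℝ) * cntP A x (rr m (z + 1)) ≤
      (((flo δ A + R • (flo δ A - flo δ A)).card : ℝ) * (2 * R + 1)) ^ 2 := by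
    exact_mod_cast hcount
  have hR1' : (1 : ℝ) ≤ R := by exact_mod_cast hR1
  have hRle : (R : ℝ) ≤ n * m ^ (K + 1) := by
    rw [hR]; push_cast; gcongr
  have h1 : (Y.card : ℝ) * cntP A x (rr m (z + 1)) ≤
      (A.card : ℝ) ^ 2 * (9 * (C0 : ℝ) ^ 2 * (R : ℝ) ^ (2 * C0 + 2)) := by
    refine hcount'.trans ?_
    calc _ ≤ ((C0 * (R : ℝ) ^ C0 * A.card) * (3 * R)) ^ 2 := by
          gcongr
          · exact hgrow R hR1
          · linarith
      _ = _ := by ring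
  have h2 : (m : ℝ) ^ (fillSet (Uset A m n x) K (z + 1)).card ≤ 2 ^ n * m ^ (K + 1) * Y.card := by
    calc (m : ℝ) ^ (fillSet (Uset A m n x) K (z + 1)).card
        ≤ m ^ ((fillSet (Uset A m n x) K z).card + 1) :=
          pow_le_pow_right₀ hm1 (fill_succ_le _ _ _)
      _ = m * m ^ (fillSet (Uset A m n x) K z).card := by rw [pow_succ]; ring
      _ ≤ m * (2 ^ z * (Y.card * min (s / rr m z) (m ^ K))) := by gcongr
      _ ≤ m * (2 ^ n * (Y.card * m ^ K)) := by
        have hrz := rr_pos m hm1 z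
        have hs0 : 0 ≤ s := by linarith
        have hq : 0 ≤ min (s / rr m z) (m ^ K) := le_min (by positivity) (by positivity)
        apply mul_le_mul_of_nonneg_left _ hm0.le
        apply mul_le_mul (pow_le_pow_right₀ (by norm_num) (by omega)) _ (by positivity) (by positivity)
        exact mul_le_mul_of_nonneg_left (min_le_right _ _) (by positivity)
      _ = _ := by ring
  calc (cntP A x (rr m (z + 1)) : ℝ) * m ^ (fillSet (Uset A m n x) K (z + 1)).card
      ≤ cntP A x (rr m (z + 1)) * (2 ^ n * m ^ (K + 1) * Y.card) := by gcongr
    _ = 2 ^ n * m ^ (K + 1) * (Y.card * cntP A x (rr m (z + 1))) := by ring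
    _ ≤ 2 ^ n * m ^ (K + 1) * ((A.card : ℝ) ^ 2 * (9 * (C0 : ℝ) ^ 2 *
        (n * m ^ (K + 1)) ^ (2 * C0 + 2))) := by
      apply mul_le_mul_of_nonneg_left _ (by positivity)
      refine h1.trans ?_
      gcongr
    _ = (A.card : ℝ) ^ 2 * ((9 * (C0 : ℝ) ^ 2 * (n : ℝ) ^ (2 * C0 + 2) * 2 ^ n) *
        (m ^ ((2 * C0 + 2) * (K + 1)) * m ^ (K + 1))) := by
      rw [mul_pow, ← pow_mul m, mul_comm (K + 1) (2 * C0 + 2)]; ring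
    _ ≤ (A.card : ℝ) ^ 2 * (m * (m ^ ((2 * C0 + 2) * (K + 1)) * m ^ (K + 1))) := by gcongr
    _ = _ := by ring

/-- slope -/
noncomputable def sl (q : ℝ × ℝ) : ℝ := q.1 / q.2

lemma sl_bds (A : Finset ℝ) (hA : (A : Set ℝ) ⊆ Set.Icc 1 2) (q : ℝ × ℝ) (hq : q ∈ A ×ˢ A) :
    1 / 2 ≤ sl q ∧ sl q ≤ 2 := by
  rw [Finset.mem_product] at hq
  have h1 := hA hq.1
  have h2 := hA hq.2
  unfold sl
  have hp : 0 < q.2 := by linarith [h2.1]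
  constructor
  · rw [le_div_iff₀ hp]; linarith [h1.1, h2.2]
  · rw [div_le_iff₀ hp]; linarith [h1.2, h2.1]

lemma InV_bd (A : Finset ℝ) (hA : (A : Set ℝ) ⊆ Set.Icc 1 2) (y : ℝ) (hy : InV A y) : |y| ≤ 1 := by
  obtain ⟨a, ha, b, hb, rfl⟩ := hy
  have h1 := hA ha
  have h2 := hA hb
  rw [abs_le]; constructor <;> linarith [h1.1, h1.2, h2.1, h2.2]

lemma lin_bd (A : Finset ℝ) (hA : (A : Set ℝ) ⊆ Set.Icc 1 2) (α β x : ℝ) (h1 : InV A α)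
    (h2 : InV A β) (hx : 1 / 2 ≤ x ∧ x ≤ 2) : |α - x * β| ≤ 3 := by
  have h3 := abs_sub α (x * β)
  have h4 := InV_bd A hA α h1
  have h5 := InV_bd A hA β h2
  rw [abs_mul, abs_of_nonneg (by linarith [hx.1] : 0 ≤ x)] at h3
  nlinarith [hx.1, hx.2, abs_nonneg β]

lemma find_w (m : ℝ) (hm : 5 ≤ m) (v : ℝ) (s : ℕ) (h1 : rr m (s + 2) < v) (h2 : v ≤ 5 * rr m s)
    (h3 : v ≤ 4) : ∃ w, w ≤ s + 1 ∧ s ≤ w + 1 ∧ rr m (w + 1) < v ∧ v ≤ rr m w := by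
  by_cases h4 : v ≤ rr m (s + 1)
  · exact ⟨s + 1, by omega, by omega, h1, h4⟩
  by_cases h5 : v ≤ rr m s
  · exact ⟨s, by omega, by omega, by linarith, h5⟩
  push Not at h4 h5
  rcases s with _ | s
  · rw [rr_zero] at h5; linarith
  · refine ⟨s, by omega, by omega, h5, ?_⟩
    have := rr_succ m (by linarith) s
    have := rr_pos m (by linarith) (s + 1)
    nlinarith

lemma cnt_pos (A : Finset ℝ) (q : ℝ × ℝ) (hq : q ∈ A ×ˢ A) (ρ : ℝ) (hρ : 0 ≤ ρ) :
    0 < cntP A (sl q) ρ := by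
  apply Finset.card_pos.2
  refine ⟨q, ?_⟩
  rw [Finset.mem_filter]
  refine ⟨hq, ?_⟩
  unfold sl
  simpa using hρ

lemma sum_inv_le (A : Finset ℝ) (S : Finset (ℝ × ℝ)) (hS : S ⊆ A ×ˢ A) (ρ : ℝ) 
    (h : ∀ q ∈ S, ∀ q' ∈ S, |sl q - sl q'| ≤ ρ) :
    ∑ q ∈ S, (1 : ℝ) / cntP A (sl q) ρ ≤ 1 := by
  rcases S.eq_empty_or_nonempty with rfl | hne
  · simp
  have hc : (0 : ℝ) < S.card := by exact_mod_cast hne.card_pos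
  calc ∑ q ∈ S, (1 : ℝ) / cntP A (sl q) ρ ≤ ∑ q ∈ S, (1 : ℝ) / S.card := by
        apply Finset.sum_le_sum
        intro q hq
        apply one_div_le_one_div_of_le hc
        norm_cast
        apply Finset.card_le_card
        intro q' hq'
        rw [Finset.mem_filter]
        exact ⟨hS hq', h q' hq' q hq⟩
    _ = 1 := by
      rw [Finset.sum_const, nsmul_eq_mul]; field_simp

lemma sum_inv_ball (A : Finset ℝ) (S : Finset (ℝ × ℝ)) (hS : S ⊆ A ×ˢ A) (ρ m y : ℝ) (hρ : 0 < ρ)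
    (hm : 1 ≤ m) (h : ∀ q ∈ S, |sl q - y| ≤ ρ * m) :
    ∑ q ∈ S, (1 : ℝ) / cntP A (sl q) ρ ≤ 2 * m + 1 := by
  set f : ℝ × ℝ → ℕ := fun q => ⌊(sl q - y + ρ * m) / ρ⌋₊ with hf
  have hnn : ∀ q ∈ S, 0 ≤ (sl q - y + ρ * m) / ρ := by
    intro q hq
    have := (abs_le.1 (h q hq)).1
    apply div_nonneg _ hρ.le; linarith
  have hmaps : ∀ q ∈ S, f q ∈ Finset.range (⌊2 * m⌋₊ + 1) := by
    intro q hq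
    rw [Finset.mem_range, Nat.lt_succ_iff]
    apply Nat.floor_le_floor
    rw [div_le_iff₀ hρ]
    have := (abs_le.1 (h q hq)).2
    linarith
  rw [← Finset.sum_fiberwise_of_maps_to hmaps]
  calc _ ≤ ∑ j ∈ Finset.range (⌊2 * m⌋₊ + 1), (1 : ℝ) := by
        apply Finset.sum_le_sum
        intro j _
        apply sum_inv_le A _ ((Finset.filter_subset _ _).trans hS)
        have hh : ∀ q ∈ S, f q = j → j * ρ ≤ sl q - y + ρ * m ∧
            sl q - y + ρ * m < (j + 1) * ρ := by
          intro q hq hqj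
          have h3 := Nat.floor_le (hnn q hq)
          have h4 := Nat.lt_floor_add_one ((sl q - y + ρ * m) / ρ)
          have h5 : ⌊(sl q - y + ρ * m) / ρ⌋₊ = j := hqj
          rw [h5] at h3 h4
          rw [le_div_iff₀ hρ] at h3
          rw [div_lt_iff₀ hρ] at h4
          exact ⟨h3, h4⟩
        intro q hq q' hq'
        rw [Finset.mem_filter] at hq hq'
        obtain ⟨x1, x2⟩ := hh q hq.1 hq.2
        obtain ⟨y1, y2⟩ := hh q' hq'.1 hq'.2
        rw [abs_le]; constructor <;> linarith
    _ = (⌊2 * m⌋₊ : ℝ) + 1 := by simp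
    _ ≤ 2 * m + 1 := by
      have := Nat.floor_le (by linarith : 0 ≤ 2 * m)
      linarith

lemma bad_card (A : Finset ℝ) (D : Finset (ℝ × ℝ)) (hD : D ⊆ A ×ˢ A) (κ M ρ ρ' : ℝ) (hκ : 0 ≤ κ)
    (hρ : 0 ≤ ρ') (h1 : ∀ q ∈ D, (cntP A (sl q) ρ' : ℝ) ≤ κ * cntP A (sl q) ρ)
    (h2 : ∀ q' ∈ A ×ˢ A, ∑ q ∈ D.filter (fun q => |sl q' - sl q| ≤ ρ),
      (1 : ℝ) / cntP A (sl q) ρ' ≤ M) :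
    (D.card : ℝ) ≤ κ * M * (A ×ˢ A).card := by
  calc (D.card : ℝ) = ∑ q ∈ D, (1 : ℝ) := by simp
    _ ≤ ∑ q ∈ D, κ * (∑ q' ∈ A ×ˢ A, if |sl q' - sl q| ≤ ρ then (1 : ℝ) / cntP A (sl q) ρ' else 0) := by
      apply Finset.sum_le_sum
      intro q hq
      have hp : (0 : ℝ) < cntP A (sl q) ρ' := by exact_mod_cast cnt_pos A q (hD hq) ρ' hρ
      rw [← Finset.sum_filter, Finset.sum_const, nsmul_eq_mul, mul_one_div, mul_div_assoc',
        le_div_iff₀ hp, one_mul]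
      exact h1 q hq
    _ = κ * ∑ q' ∈ A ×ˢ A, ∑ q ∈ D.filter (fun q => |sl q' - sl q| ≤ ρ),
          (1 : ℝ) / cntP A (sl q) ρ' := by
      rw [← Finset.mul_sum, Finset.sum_comm]
      simp_rw [← Finset.sum_filter]
    _ ≤ κ * ∑ q' ∈ A ×ˢ A, M := by
      gcongr with q' hq'
      exact h2 q' hq'
    _ = _ := by rw [Finset.sum_const, nsmul_eq_mul]; ring

lemma bad2_card (A : Finset ℝ) (D : Finset (ℝ × ℝ)) (hD : D ⊆ A ×ˢ A) (κ ρ ρ' : ℝ) (hκ : 0 ≤ κ)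
    (hρ : 0 ≤ ρ') (h1 : ∀ q ∈ D, (cntP A (sl q) ρ' : ℝ) ≤ κ * cntP A (sl q) ρ)
    (h2 : ∀ q ∈ D, ∀ q' ∈ D, |sl q - sl q'| ≤ ρ → |sl q - sl q'| ≤ ρ') :
    (D.card : ℝ) ≤ κ * 2 * (A ×ˢ A).card := by
  apply bad_card A D hD κ 2 ρ ρ' hκ hρ h1
  intro q0 hq0
  set E := D.filter (fun q => |sl q0 - sl q| ≤ ρ) with hE
  rw [← Finset.sum_filter_add_sum_filter_not E (fun q => sl q ≤ sl q0)]
  have hED : E ⊆ D := Finset.filter_subset _ _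
  have e1 := sum_inv_le A (E.filter (fun q => sl q ≤ sl q0))
    ((Finset.filter_subset _ _).trans (hED.trans hD)) ρ' (by
      intro q hq q' hq'
      rw [Finset.mem_filter, hE, Finset.mem_filter] at hq hq'
      apply h2 q hq.1.1 q' hq'.1.1
      have a1 := abs_le.1 hq.1.2
      have a2 := abs_le.1 hq'.1.2
      rw [abs_le]; constructor <;> linarith [a1.1, a1.2, a2.1, a2.2, hq.2, hq'.2])
  have e2 := sum_inv_le A (E.filter (fun q => ¬ sl q ≤ sl q0))
    ((Finset.filter_subset _ _).trans (hED.trans hD)) ρ' (by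
      intro q hq q' hq'
      rw [Finset.mem_filter, hE, Finset.mem_filter] at hq hq'
      apply h2 q hq.1.1 q' hq'.1.1
      have a1 := abs_le.1 hq.1.2
      have a2 := abs_le.1 hq'.1.2
      rw [abs_le]; constructor <;> linarith [a1.1, a1.2, a2.1, a2.2, not_le.1 hq.2, not_le.1 hq'.2])
  linarith

lemma good_exists (A : Finset ℝ) (hA : (A : Set ℝ) ⊆ Set.Icc 1 2) (m : ℝ) (hm : 5 ≤ m) (n : ℕ)
    (hn : 1 ≤ n) (η : ℝ) (hη : η = 1 / (12 * (n : ℝ) ^ 2)) :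
    ∃ G ⊆ A ×ˢ A, ((A ×ˢ A).card : ℝ) ≤ 2 * G.card ∧ ∀ q ∈ G,
      (∀ u < n, η / m * cntP A (sl q) (rr m u) ≤ cntP A (sl q) (rr m (u + 1))) ∧
      (∀ t, ∀ u ∈ UsSet A m η n (sl q), ∀ z ≤ n, t + u + 2 ≤ z → t ∈ TT A m (sl q) z →
        ∃ w ∈ Uset A m n (sl q), w ≤ t + u + 1 ∧ t + u ≤ w + 1) := by
  classical
  have hm1 : 1 ≤ m := by linarith
  have hη0 : 0 ≤ η := by rw [hη]; positivity
  set P := A ×ˢ A with hP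
  set D1 : ℕ → Finset (ℝ × ℝ) := fun u => P.filter (fun q =>
    (cntP A (sl q) (rr m (u + 1)) : ℝ) < η / m * cntP A (sl q) (rr m u)) with hD1
  set D2 : ℕ → ℕ → Finset (ℝ × ℝ) := fun t u => P.filter (fun q =>
    u ∈ UsSet A m η n (sl q) ∧ ∃ z ≤ n, t + u + 2 ≤ z ∧ t ∈ TT A m (sl q) z ∧
      ¬ ∃ w ∈ Uset A m n (sl q), w ≤ t + u + 1 ∧ t + u ≤ w + 1) with hD2
  have hD1c : ∀ u, ((D1 u).card : ℝ) ≤ 3 * η * P.card := by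
    intro u
    have hb := bad_card A (D1 u) (Finset.filter_subset _ _) (η / m) (2 * m + 1) (rr m u)
      (rr m (u + 1)) (by positivity) (rr_pos m hm1 _).le
      (fun q hq => (Finset.mem_filter.1 hq).2.le) (by
        intro q' hq'
        apply sum_inv_ball A _ _ _ m (sl q') (rr_pos m hm1 _) hm1
        · intro q hq
          rw [rr_succ m hm1, abs_sub_comm]
          exact (Finset.mem_filter.1 hq).2
        · exact (Finset.filter_subset _ _).trans (Finset.filter_subset _ _))
    refine hb.trans ?_
    apply mul_le_mul_of_nonneg_right _ (by positivity)
    have : η / m * (2 * m + 1) ≤ η / m * (3 * m) := by gcongr; linarith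
    refine this.trans (le_of_eq ?_)
    field_simp
  have hD2c : ∀ t u, ((D2 t u).card : ℝ) ≤ η * 2 * P.card := by
    intro t u
    apply bad2_card A (D2 t u) (Finset.filter_subset _ _) η (rr m u) (rr m (u + 1)) hη0
      (rr_pos m hm1 _).le
    · intro q hq
      have := (Finset.mem_filter.1 hq).2.1
      exact (Finset.mem_filter.1 this).2
    · intro q hq q' hq' hle
      by_contra hlt
      push Not at hlt
      obtain ⟨hqP, hu, z, hzn, htz, ht, -⟩ := Finset.mem_filter.1 hq
      obtain ⟨hqP', -, -, -, -, -, hno⟩ := Finset.mem_filter.1 hq'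
      apply hno
      obtain ⟨htz', α, β, hα, hβ, h1, h2, h3⟩ := (mem_TT _ _ _ _ _).1 ht
      have hx' := sl_bds A hA q' hqP'
      have hv3 := lin_bd A hA α β (sl q') hα hβ hx'
      have e : α - sl q' * β = (α - sl q * β) + (sl q - sl q') * β := by ring
      have hz2 := rr_anti m hm1 htz
      have hmul : |(sl q - sl q') * β| ≤ 4 * rr m (t + u) := by
        rw [abs_mul, add_comm t u, ← rr_add m hm1]
        exact mul_le_mul hle h2 (abs_nonneg _) (rr_pos m hm1 _).le
      have hmul2 : 4 * rr m (t + u + 2) ≤ |(sl q - sl q') * β| := by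
        rw [abs_mul, show t + u + 2 = (u + 1) + (t + 1) by ring, ← rr_add m hm1]
        exact mul_le_mul hlt.le h1.le (rr_pos m hm1 _).le (abs_nonneg _)
      have hanti := rr_anti m hm1 (show t + u ≤ t + u + 2 by omega)
      have hpos := rr_pos m hm1 (t + u + 2)
      have t1 := abs_add_le (α - sl q * β) ((sl q - sl q') * β)
      have t2 : |(sl q - sl q') * β| ≤ |α - sl q' * β| + |α - sl q * β| := by
        have := abs_sub (α - sl q' * β) (α - sl q * β)
        rwa [show α - sl q' * β - (α - sl q * β) = (sl q - sl q') * β by ring] at this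
      rw [← e] at t1
      obtain ⟨w, hw1, hw2, hw3, hw4⟩ := find_w m hm |α - sl q' * β| (t + u) (by linarith)
        (by linarith) (by linarith)
      exact ⟨w, (mem_Uset _ _ _ _ _).2 ⟨by omega, α, β, hα, hβ, hw3, hw4⟩, hw1, hw2⟩
  set Bad := (Finset.range n).biUnion (fun u => D1 u ∪ (Finset.range n).biUnion (fun t => D2 t u))
    with hBad
  have hBadc : (Bad.card : ℝ) ≤ 5 * (n : ℝ) ^ 2 * η * P.card := by
    have h1 : (Bad.card : ℝ) ≤ ∑ u ∈ Finset.range n, ((D1 u).card +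
        ∑ t ∈ Finset.range n, (D2 t u).card : ℝ) := by
      have : Bad.card ≤ ∑ u ∈ Finset.range n, ((D1 u).card + ∑ t ∈ Finset.range n, (D2 t u).card) := by
        refine Finset.card_biUnion_le.trans ?_
        gcongr with u hu
        refine (Finset.card_union_le _ _).trans ?_
        gcongr
        exact Finset.card_biUnion_le
      exact_mod_cast this
    refine h1.trans ?_
    calc _ ≤ ∑ u ∈ Finset.range n, (3 * η * P.card + ∑ t ∈ Finset.range n, η * 2 * P.card : ℝ) := by
          apply Finset.sum_le_sum
          intro u _
          apply add_le_add (hD1c u)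
          rw [Nat.cast_sum]
          apply Finset.sum_le_sum
          intro t _
          exact hD2c t u
      _ = (3 * n + 2 * (n : ℝ) ^ 2) * (η * P.card) := by
          simp only [Finset.sum_const, Finset.card_range, nsmul_eq_mul]; ring
      _ ≤ (5 * (n : ℝ) ^ 2) * (η * P.card) := by
          gcongr
          have : (1 : ℝ) ≤ n := by exact_mod_cast hn
          nlinarith
      _ = _ := by ring
  have hn0 : (0 : ℝ) < n := by exact_mod_cast hn
  have hBadc' : (Bad.card : ℝ) ≤ 5 / 12 * P.card := by
    refine hBadc.trans (le_of_eq ?_)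
    rw [hη]; field_simp
  refine ⟨P \ Bad, Finset.sdiff_subset, ?_, ?_⟩
  · have h1 : (P.card : ℝ) ≤ (P \ Bad).card + Bad.card := by
      exact_mod_cast (by
        have := Finset.le_card_sdiff Bad P
        omega : P.card ≤ (P \ Bad).card + Bad.card)
    have : (0 : ℝ) ≤ P.card := by positivity
    linarith
  · intro q hq
    rw [Finset.mem_sdiff] at hq
    obtain ⟨hqP, hqB⟩ := hq
    constructor
    · intro u hu
      by_contra hlt
      push Not at hlt
      apply hqB
      rw [hBad, Finset.mem_biUnion]
      exact ⟨u, Finset.mem_range.2 hu, Finset.mem_union_left _ (Finset.mem_filter.2 ⟨hqP, hlt⟩)⟩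
    · intro t u hu z hz htz ht
      by_contra hno
      apply hqB
      rw [hBad, Finset.mem_biUnion]
      refine ⟨u, (Finset.mem_filter.1 hu).1, Finset.mem_union_right _ ?_⟩
      rw [Finset.mem_biUnion]
      refine ⟨t, Finset.mem_range.2 (by omega), Finset.mem_filter.2 ⟨hqP, hu, z, hz, htz, ht, hno⟩⟩

lemma iv0_lemma (A : Finset ℝ) (hA : (A : Set ℝ) ⊆ Set.Icc 1 2) (m : ℝ) (hm : 5 ≤ m) (n : ℕ)
    (η : ℝ) (hη : η < 1) (q : ℝ × ℝ) (hq : q ∈ A ×ˢ A) :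
    ∀ u ∈ UsSet A m η n (sl q), ∃ w ∈ Uset A m n (sl q), w ≤ u + 1 ∧ u ≤ w + 1 := by
  intro u hu
  have hm1 : 1 ≤ m := by linarith
  obtain ⟨hun, hle⟩ := Finset.mem_filter.1 hu
  rw [Finset.mem_range] at hun
  have hp : (0 : ℝ) < cntP A (sl q) (rr m u) := by
    exact_mod_cast cnt_pos A q hq _ (rr_pos m hm1 _).le
  have hlt : (cntP A (sl q) (rr m (u + 1)) : ℝ) < cntP A (sl q) (rr m u) := by nlinarith
  have hlt' : cntP A (sl q) (rr m (u + 1)) < cntP A (sl q) (rr m u) := by exact_mod_cast hlt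
  obtain ⟨q', hq', hnq'⟩ := Finset.exists_mem_notMem_of_card_lt_card hlt'
  rw [Finset.mem_filter] at hq' hnq'
  obtain ⟨hqP', h1⟩ := hq'
  have h2 : rr m (u + 1) < |q'.1 / q'.2 - sl q| := by
    by_contra h
    exact hnq' ⟨hqP', not_lt.1 h⟩
  have hqm := Finset.mem_product.1 hq
  have hqm' := Finset.mem_product.1 hqP'
  have hb2 := hA hqm.2
  have hb2' := hA hqm'.2
  have hα : InV A (q'.1 - q.1) := ⟨_, hqm'.1, _, hqm.1, rfl⟩
  have hβ : InV A (q'.2 - q.2) := ⟨_, hqm'.2, _, hqm.2, rfl⟩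
  have hne : q.2 ≠ 0 := by have := hb2.1; intro h; linarith
  have hne' : q'.2 ≠ 0 := by have := hb2'.1; intro h; linarith
  have e : (q'.1 - q.1) - sl q * (q'.2 - q.2) = q'.2 * (q'.1 / q'.2 - sl q) := by
    unfold sl; field_simp; ring
  have hv : |(q'.1 - q.1) - sl q * (q'.2 - q.2)| = q'.2 * |q'.1 / q'.2 - sl q| := by
    rw [e, abs_mul, abs_of_nonneg (by linarith [hb2'.1] : 0 ≤ q'.2)]
  have hpos := rr_pos m hm1 u
  have hpos1 := rr_pos m hm1 (u + 1)
  have hl : rr m (u + 1) < |(q'.1 - q.1) - sl q * (q'.2 - q.2)| := by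
    rw [hv]; nlinarith [hb2'.1]
  have hr : |(q'.1 - q.1) - sl q * (q'.2 - q.2)| ≤ 2 * rr m u := by
    rw [hv]; nlinarith [hb2'.1, hb2'.2]
  have hv3 := lin_bd A hA _ _ (sl q) hα hβ (sl_bds A hA q hq)
  have hanti := rr_anti m hm1 (show u + 1 ≤ u + 2 by omega)
  obtain ⟨w, hw1, hw2, hw3, hw4⟩ := find_w m hm _ u (by linarith) (by linarith)
    (by linarith : |(q'.1 - q.1) - sl q * (q'.2 - q.2)| ≤ 4)
  refine ⟨w, (mem_Uset _ _ _ _ _).2 ⟨?_, _, _, hα, hβ, hw3, hw4⟩, hw1, hw2⟩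
  by_contra hwn
  have := rr_anti m hm1 (show u + 1 ≤ w by omega)
  linarith

lemma cnt_lower (A : Finset ℝ) (hA : (A : Set ℝ) ⊆ Set.Icc 1 2) (m : ℝ) (hm : 5 ≤ m) (n : ℕ)
    (η : ℝ) (hη0 : 0 < η) (q : ℝ × ℝ) (hq : q ∈ A ×ˢ A)
    (hg : ∀ u < n, η / m * cntP A (sl q) (rr m u) ≤ cntP A (sl q) (rr m (u + 1))) :
    ∀ z ≤ n, ((A ×ˢ A).card : ℝ) * η ^ z ≤
      cntP A (sl q) (rr m z) * m ^ (cntBelow (UsSet A m η n (sl q)) z) := by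
  intro z
  induction z with
  | zero =>
    intro _
    have : cntP A (sl q) (rr m 0) = (A ×ˢ A).card := by
      unfold cntP
      congr 1
      apply Finset.filter_true_of_mem
      intro q' hq'
      have h1 := sl_bds A hA q hq
      have h2 := sl_bds A hA q' hq'
      have h3 : q'.1 / q'.2 = sl q' := rfl
      rw [h3, rr_zero, abs_le]
      constructor <;> linarith [h1.1, h1.2, h2.1, h2.2]
    rw [this]; simp [cntBelow]
  | succ z ih =>
    intro hz
    have ih' := ih (by omega)
    have hm0 : 0 < m := by linarith
    set Us := UsSet A m η n (sl q) with hUs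
    by_cases hzU : z ∈ Us
    · have hc : cntBelow Us (z + 1) = cntBelow Us z + 1 := by
        unfold cntBelow
        have : Us.filter (fun t => t < z + 1) = insert z (Us.filter (fun t => t < z)) := by
          ext t; simp only [Finset.mem_filter, Finset.mem_insert]
          constructor
          · rintro ⟨h1, h2⟩
            by_cases h3 : t = z
            · left; exact h3
            · right; exact ⟨h1, by omega⟩
          · rintro (rfl | ⟨h1, h2⟩)
            · exact ⟨hzU, by omega⟩
            · exact ⟨h1, by omega⟩
        rw [this, Finset.card_insert_of_notMem (by simp)]
      have h1 := hg z (by omega)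
      rw [div_mul_eq_mul_div, div_le_iff₀ hm0] at h1
      rw [hc, pow_succ, pow_succ]
      calc _ = ((A ×ˢ A).card * η ^ z) * η := by ring
        _ ≤ (cntP A (sl q) (rr m z) * m ^ cntBelow Us z) * η := by gcongr
        _ = (η * cntP A (sl q) (rr m z)) * m ^ cntBelow Us z := by ring
        _ ≤ (cntP A (sl q) (rr m (z + 1)) * m) * m ^ cntBelow Us z := by gcongr
        _ = _ := by ring
    · have hc : cntBelow Us z ≤ cntBelow Us (z + 1) := by
        apply Finset.card_le_card
        intro t ht
        rw [Finset.mem_filter] at ht ⊢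
        exact ⟨ht.1, by omega⟩
      have h1 : η * cntP A (sl q) (rr m z) ≤ cntP A (sl q) (rr m (z + 1)) := by
        by_contra h
        apply hzU
        rw [hUs]
        exact Finset.mem_filter.2 ⟨Finset.mem_range.2 (by omega), (not_le.1 h).le⟩
      rw [pow_succ]
      calc _ = ((A ×ˢ A).card * η ^ z) * η := by ring
        _ ≤ (cntP A (sl q) (rr m z) * m ^ cntBelow Us z) * η := by gcongr
        _ = (η * cntP A (sl q) (rr m z)) * m ^ cntBelow Us z := by ring
        _ ≤ (cntP A (sl q) (rr m (z + 1))) * m ^ cntBelow Us z := by gcongr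
        _ ≤ _ := by
          gcongr
          linarith

lemma fill_three (Us U : Finset ℕ) (n : ℕ) (h : ∀ u ∈ Us, ∃ w ∈ U, w ≤ u + 1 ∧ u ≤ w + 1) :
    cntBelow Us n ≤ (fillSet U 3 n).card + 1 := by
  have h1 : ((Us.filter (fun u => u < n)).image (fun u => u + 1)) ⊆ insert n (fillSet U 3 n) := by
    intro v hv
    simp only [Finset.mem_image, Finset.mem_filter] at hv
    obtain ⟨u, ⟨hu, hun⟩, rfl⟩ := hv
    obtain ⟨w, hw, h1, h2⟩ := h u hu
    simp only [Finset.mem_insert, fillSet, Finset.mem_filter, Finset.mem_range]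
    by_cases h3 : u + 1 = n
    · left; exact h3
    · right; exact ⟨by omega, w, hw, by omega, by omega⟩
  have h2 := Finset.card_le_card h1
  rw [Finset.card_image_of_injective _ (fun a b hab => by simpa using hab)] at h2
  exact h2.trans (Finset.card_insert_le _ _)

lemma slope_count (σ th K L : ℝ) (hσ0 : 0 < σ) (hσ1 : σ < 1) (hth : th < min σ (1 - σ) / 2)
    (hK : 1 ≤ K) (hL : 1 ≤ L) :
    ∃ δ0 : ℝ, 0 < δ0 ∧ ∀ δ : ℝ, 0 < δ → δ ≤ δ0 → ∀ A : Finset ℝ, A.Nonempty →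
      (A : Set ℝ) ⊆ Set.Icc 1 2 → IsDeltaSigmaSet K δ σ A →
      ((coveringNumber δ ((A : Set ℝ) + (A : Set ℝ)) : ℝ) ≤ L * (A.card : ℝ) ∨
        (coveringNumber δ ((A : Set ℝ) - (A : Set ℝ)) : ℝ) ≤ L * (A.card : ℝ)) →
      ∃ G ⊆ A ×ˢ A, ((A ×ˢ A).card : ℝ) ≤ 2 * G.card ∧
        ∀ q ∈ G, (cntP A (sl q) (4 * δ) : ℝ) * δ ^ (-(σ + th)) ≤ (A.card : ℝ) ^ 2 := by
  obtain ⟨C0, hC0, hgrow⟩ := energy_growth L hL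
  set E : ℕ → ℕ := fun k => (2 * C0 + 2) * (k + 1) + k + 2 with hE
  obtain ⟨C', th', hth', hC', hcomb⟩ := comb_main σ th 3 (fun k => (E k : ℝ) + 1) hσ0 hσ1 hth
    (by norm_num) (fun k => by positivity)
  obtain ⟨n0, hn0⟩ := exists_nat_ge ((C' + 1 + E 3) / (th' - th))
  set n := n0 + 1 with hn
  have hn1 : 1 ≤ n := by omega
  have hnbig : C' + 1 + E 3 ≤ n * (th' - th) := by
    rw [div_le_iff₀ (by linarith)] at hn0
    rw [hn]; push_cast
    nlinarith
  set η : ℝ := 1 / (12 * (n : ℝ) ^ 2) with hη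
  have hnR : (1 : ℝ) ≤ n := by exact_mod_cast hn1
  have hη0 : 0 < η := by positivity
  have hη1 : η < 1 := by
    rw [hη, div_lt_one (by positivity)]; nlinarith
  set m0 : ℝ := 5 + 8 * K + 32 * K ^ 2 * 2 ^ n + 9 * (C0 : ℝ) ^ 2 * (n : ℝ) ^ (2 * C0 + 2) * 2 ^ n
    + (η ^ n)⁻¹ with hm0
  have hp1 : 0 ≤ 32 * K ^ 2 * 2 ^ n := by positivity
  have hp2 : 0 ≤ 9 * (C0 : ℝ) ^ 2 * (n : ℝ) ^ (2 * C0 + 2) * 2 ^ n := by positivity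
  have hp3 : 0 < (η ^ n)⁻¹ := by positivity
  have hm0pos : 0 < m0 := by linarith
  refine ⟨(m0 ^ n)⁻¹, by positivity, ?_⟩
  intro δ hδ hδ0 A hne hA hset hcl
  obtain ⟨hsep, hcard1, hcard2, hF⟩ := hset
  set m : ℝ := (δ⁻¹) ^ ((n : ℝ)⁻¹) with hm
  have hmn : m ^ n = δ⁻¹ := Real.rpow_inv_natCast_pow (by positivity) (by omega)
  have hmm0 : m0 ≤ m := by
    have h1 : m0 ^ n ≤ m ^ n := by
      rw [hmn, le_inv_comm₀ (by positivity) hδ]; exact hδ0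
    exact le_of_pow_le_pow_left₀ (by omega) (by positivity) h1
  have hm5 : 5 ≤ m := by linarith
  have hm1 : 1 < m := by linarith
  have hmp : 0 < m := by linarith
  have hrn : rr m n = 4 * δ := by
    unfold rr; rw [hmn]; field_simp
  obtain ⟨G, hG, hGc, hGq⟩ := good_exists A hA m hm5 n hn1 η hη
  refine ⟨G, hG, hGc, ?_⟩
  intro q hq
  obtain ⟨hg1, hg2⟩ := hGq q hq
  have hqA := hG hq
  set x := sl q with hx
  have hxb := sl_bds A hA q hqA
  set Us := UsSet A m η n x with hUs
  set U := Uset A m n x with hU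
  have hAc : ((A ×ˢ A).card : ℝ) = (A.card : ℝ) ^ 2 := by
    rw [Finset.card_product]; push_cast; ring
  have hApos : 0 < (A.card : ℝ) := by exact_mod_cast hne.card_pos
  have hiv0 := iv0_lemma A hA m hm5 n η hη1 q hqA
  have hpart2 := fun k hk z hz => part2 A hne hA δ hδ hsep x hxb C0
    (hgrow δ hδ A hne hsep hcl) m n hm5 hn1 (by linarith) (by rw [hrn]; linarith) k hk z hz
  have hcpos : ∀ z, 0 < (cntP A x (rr m z) : ℝ) := by
    intro z
    exact_mod_cast cnt_pos A q hqA _ (rr_pos m hm1.le z).le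
  have hlow : ∀ z ≤ n, (A.card : ℝ) ^ 2 ≤ cntP A x (rr m z) * m ^ (cntBelow Us z + 1) := by
    intro z hz
    have h1 := cnt_lower A hA m hm5 n η hη0 q hqA hg1 z hz
    rw [hAc] at h1
    have h2 : 1 ≤ η ^ z * m := by
      have h3 : η ^ n ≤ η ^ z := pow_le_pow_of_le_one hη0.le hη1.le hz
      have h4 : (η ^ n)⁻¹ ≤ m := by linarith
      have h5 : 0 < η ^ n := by positivity
      calc 1 = η ^ n * (η ^ n)⁻¹ := by field_simp
        _ ≤ η ^ z * m := by gcongr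
    calc (A.card : ℝ) ^ 2 ≤ (A.card : ℝ) ^ 2 * (η ^ z * m) :=
          le_mul_of_one_le_right (by positivity) h2
      _ = ((A.card : ℝ) ^ 2 * η ^ z) * m := by ring
      _ ≤ (cntP A x (rr m z) * m ^ (cntBelow Us z)) * m := by gcongr
      _ = _ := by rw [pow_succ]; ring
  have hlogic : ∀ z ≤ n, ∀ e : ℝ, (cntP A x (rr m z) : ℝ) ≤ (A.card : ℝ) ^ 2 * m ^ e →
      -e - 1 ≤ cntBelow Us z := by
    intro z hz e he
    have h1 := hlow z hz
    have h2 : (A.card : ℝ) ^ 2 * 1 ≤ (A.card : ℝ) ^ 2 * m ^ (e + (cntBelow Us z + 1)) := by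
      rw [mul_one]
      calc (A.card : ℝ) ^ 2 ≤ cntP A x (rr m z) * m ^ (cntBelow Us z + 1) := h1
        _ ≤ ((A.card : ℝ) ^ 2 * m ^ e) * m ^ (cntBelow Us z + 1) := by gcongr
        _ = _ := by
          rw [Real.rpow_add hmp, mul_assoc]
          congr 2
          rw [← Real.rpow_natCast]; push_cast; rfl
    have h3 := le_of_mul_le_mul_left h2 (by positivity)
    have h3' : m ^ (0 : ℝ) ≤ m ^ (e + (cntBelow Us z + 1)) := by rw [Real.rpow_zero]; exact h3
    rw [Real.rpow_le_rpow_left_iff hm1] at h3'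
    linarith
  set T : ℕ → Finset ℕ := fun z => if z = 0 then ∅ else TT A m x (z - 1) with hT
  have hTmem : ∀ z t, t ∈ T z → 1 ≤ z ∧ t ∈ TT A m x (z - 1) := by
    intro z t ht
    simp only [hT] at ht
    split_ifs at ht with h
    · simp at ht
    · exact ⟨by omega, ht⟩
  have hfinal := hcomb n Us U T ?_ ?_ ?_ hiv0 ?_ ?_
  · have h3 := fill_three Us U n hiv0
    have h3' : (cntBelow Us n : ℝ) ≤ (fillSet U 3 n).card + 1 := by exact_mod_cast h3
    have h4 := hpart2 3 (by norm_num) n le_rfl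
    rw [← hrn]
    have h5 : δ ^ (-(σ + th)) = m ^ ((n : ℝ) * (σ + th)) := by
      rw [Real.rpow_mul hmp.le, Real.rpow_natCast, hmn, Real.inv_rpow hδ.le, Real.rpow_neg hδ.le]
    have h6 : δ ^ (-(σ + th)) * m ^ (E 3) ≤ m ^ (fillSet U 3 n).card := by
      rw [h5, ← Real.rpow_natCast m (E 3), ← Real.rpow_add hmp,
        ← Real.rpow_natCast m (fillSet U 3 n).card]
      apply Real.rpow_le_rpow_of_exponent_le hm1.le
      linarith
    have hmE : 0 < m ^ (E 3) := by positivity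
    apply le_of_mul_le_mul_right _ hmE
    calc (cntP A x (rr m n) : ℝ) * δ ^ (-(σ + th)) * m ^ (E 3)
        = cntP A x (rr m n) * (δ ^ (-(σ + th)) * m ^ (E 3)) := by ring
      _ ≤ cntP A x (rr m n) * m ^ (fillSet U 3 n).card := by gcongr
      _ ≤ _ := h4
  · intro z t ht
    obtain ⟨h1, h2⟩ := hTmem z t ht
    have := ((mem_TT _ _ _ _ _).1 h2).1
    omega
  · intro z hz
    rcases z with _ | z
    · simp only [hT]
      have : (0 : ℝ) ≤ cntBelow Us 0 := by positivity
      simp; linarith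
    · have h1 := part3b A hA σ δ K m x hσ0 hσ1 hK hδ hF z n hz (by linarith) (by rw [hrn]; linarith)
      have h2 := hlogic (z + 1) hz _ h1
      simp only [hT, Nat.add_eq_zero_iff, one_ne_zero, and_false, if_false, Nat.add_sub_cancel]
      push_cast
      linarith
  · intro k hk z hz
    have h1 := hpart2 k hk z hz
    have h2 := hlow z hz
    have h3 : (cntP A x (rr m z) : ℝ) * m ^ (fillSet U k z).card ≤
        cntP A x (rr m z) * m ^ (cntBelow Us z + 1 + E k) := by
      refine h1.trans ?_
      rw [pow_add m _ (E k), ← mul_assoc]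
      gcongr
    have h4 := le_of_mul_le_mul_left h3 (hcpos z)
    rw [pow_le_pow_iff_right₀ hm1] at h4
    have h5 : ((fillSet U k z).card : ℝ) ≤ ((cntBelow Us z + 1 + E k : ℕ) : ℝ) := by exact_mod_cast h4
    push_cast at h5
    linarith
  · intro z hz t ht u hu htu
    obtain ⟨h1, h2⟩ := hTmem z t ht
    exact hg2 t u hu (z - 1) (by omega) (by omega) h2
  · intro z hz
    have h1 := part3a A hA σ δ K m x hσ0 hσ1 hK hδ hF z n hz (by linarith) (by rw [hrn]; linarith)
    have h2 := hlogic z hz _ h1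
    linarith

lemma divSet_finite (A : Finset ℝ) : (divSet (A : Set ℝ) (A : Set ℝ)).Finite := by
  apply ((A ×ˢ A).image (fun q => q.1 / q.2)).finite_toSet.subset
  rintro x ⟨a, ha, b, hb, _, rfl⟩
  simp only [Finset.coe_image, Set.mem_image]
  exact ⟨(a, b), by simpa using ⟨ha, hb⟩, rfl⟩

lemma div_main (σ th K L : ℝ) (hσ0 : 0 < σ) (hσ1 : σ < 1) (hth : th < min σ (1 - σ) / 2)
    (hK : 1 ≤ K) (hL : 1 ≤ L) :
    ∃ δ0 : ℝ, 0 < δ0 ∧ ∀ δ : ℝ, 0 < δ → δ ≤ δ0 → ∀ A : Finset ℝ, A.Nonempty →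
      (A : Set ℝ) ⊆ Set.Icc 1 2 → IsDeltaSigmaSet K δ σ A →
      ((coveringNumber δ ((A : Set ℝ) + (A : Set ℝ)) : ℝ) ≤ L * (A.card : ℝ) ∨
        (coveringNumber δ ((A : Set ℝ) - (A : Set ℝ)) : ℝ) ≤ L * (A.card : ℝ)) →
      δ ^ (-th) * A.card ≤ 2 * K * coveringNumber δ (divSet (A : Set ℝ) (A : Set ℝ)) := by
  obtain ⟨δ0, hδ0, H⟩ := slope_count σ th K L hσ0 hσ1 hth hK hL
  refine ⟨δ0, hδ0, ?_⟩
  intro δ hδ hle A hne hA hset hcl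
  obtain ⟨G, hG, hGc, hGq⟩ := H δ hδ hle A hne hA hset hcl
  obtain ⟨hsep, hcard1, hcard2, hF⟩ := hset
  obtain ⟨t, htc, htS⟩ := covering_attained δ hδ _ (divSet_finite A)
  rw [← htc]
  have hAc : ((A ×ˢ A).card : ℝ) = (A.card : ℝ) ^ 2 := by
    rw [Finset.card_product]; push_cast; ring
  have hApos : 0 < (A.card : ℝ) := by exact_mod_cast hne.card_pos
  have hcov : G ⊆ t.biUnion (fun x => G.filter (fun q => sl q ∈ Set.Icc x (x + δ))) := by
    intro q hq
    have hqA := Finset.mem_product.1 (hG hq)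
    have hb := hA hqA.2
    have h1 : sl q ∈ divSet (A : Set ℝ) (A : Set ℝ) :=
      ⟨q.1, hqA.1, q.2, hqA.2, by have := hb.1; intro h; linarith, rfl⟩
    have h2 := htS h1
    simp only [Set.mem_iUnion] at h2
    obtain ⟨x, hx, hxm⟩ := h2
    rw [Finset.mem_biUnion]
    exact ⟨x, hx, Finset.mem_filter.2 ⟨hq, hxm⟩⟩
  have hD : 0 < δ ^ (-(σ + th)) := by positivity
  have hfib : ∀ x ∈ t, ((G.filter (fun q => sl q ∈ Set.Icc x (x + δ))).card : ℝ) ≤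
      (A.card : ℝ) ^ 2 / δ ^ (-(σ + th)) := by
    intro x _
    rcases (G.filter (fun q => sl q ∈ Set.Icc x (x + δ))).eq_empty_or_nonempty with h | ⟨q0, hq0⟩
    · rw [h]; simp; positivity
    · have hq0' := Finset.mem_filter.1 hq0
      have h1 := hGq q0 hq0'.1
      rw [le_div_iff₀ hD]
      refine le_trans ?_ h1
      gcongr
      apply Finset.card_le_card
      intro q hq
      have hq' := Finset.mem_filter.1 hq
      rw [Finset.mem_filter]
      refine ⟨hG hq'.1, ?_⟩
      have a1 := hq'.2.1
      have a2 := hq'.2.2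
      have b1 := hq0'.2.1
      have b2 := hq0'.2.2
      change |sl q - sl q0| ≤ 4 * δ
      rw [abs_le]; constructor <;> linarith
  have h1 : (G.card : ℝ) ≤ t.card * ((A.card : ℝ) ^ 2 / δ ^ (-(σ + th))) := by
    have h2 : (G.card : ℝ) ≤
        ∑ x ∈ t, ((G.filter (fun q => sl q ∈ Set.Icc x (x + δ))).card : ℝ) := by
      exact_mod_cast (Finset.card_le_card hcov).trans Finset.card_biUnion_le
    refine h2.trans ((Finset.sum_le_sum hfib).trans ?_)
    simp
  rw [hAc] at hGc
  have h2 : (A.card : ℝ) ^ 2 * δ ^ (-(σ + th)) ≤ (A.card : ℝ) ^ 2 * (2 * t.card) := by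
    rw [← mul_div_assoc, le_div_iff₀ hD] at h1
    nlinarith
  have h3 := le_of_mul_le_mul_left h2 (by positivity)
  have h4 : δ ^ (-(σ + th)) = δ ^ (-th) * δ ^ (-σ) := by
    rw [← Real.rpow_add hδ]; congr 1; ring
  rw [h4] at h3
  calc δ ^ (-th) * A.card ≤ δ ^ (-th) * (K * δ ^ (-σ)) := by gcongr
    _ = K * (δ ^ (-th) * δ ^ (-σ)) := by ring
    _ ≤ K * (2 * t.card) := by gcongr
    _ = _ := by ring

lemma covering_le (δ : ℝ) (S : Set ℝ) (t : Finset ℝ) (h : S ⊆ ⋃ x ∈ t, Set.Icc x (x + δ)) :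
    coveringNumber δ S ≤ t.card := Nat.sInf_le ⟨t, rfl, h⟩

lemma mul_finite (A : Finset ℝ) : ((A : Set ℝ) * (A : Set ℝ)).Finite :=
  A.finite_toSet.mul A.finite_toSet

lemma ruzsa_div (A : Finset ℝ) (hA : (A : Set ℝ) ⊆ Set.Icc 1 2) (δ : ℝ) (hδ : 0 < δ)
    (hsep : ∀ x ∈ A, ∀ y ∈ A, x ≠ y → δ ≤ |x - y|) :
    coveringNumber δ (divSet (A : Set ℝ) (A : Set ℝ)) * A.card ≤
      8 * coveringNumber δ ((A : Set ℝ) * (A : Set ℝ)) ^ 2 := by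
  classical
  set F : Finset ℤ := (A ×ˢ A).image (fun q => ⌊sl q / δ⌋) with hF
  have h1 : coveringNumber δ (divSet (A : Set ℝ) (A : Set ℝ)) ≤ F.card := by
    refine (covering_le δ _ (F.image (fun k : ℤ => (k : ℝ) * δ)) ?_).trans Finset.card_image_le
    rintro x ⟨a, ha, b, hb, _, rfl⟩
    simp only [Set.mem_iUnion]
    refine ⟨(⌊(a / b) / δ⌋ : ℝ) * δ, ?_, ?_, ?_⟩
    · rw [Finset.mem_image]
      refine ⟨_, ?_, rfl⟩
      rw [hF, Finset.mem_image]
      exact ⟨(a, b), Finset.mem_product.2 ⟨ha, hb⟩, rfl⟩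
    · have := Int.floor_le ((a / b) / δ)
      rwa [le_div_iff₀ hδ] at this
    · have := Int.lt_floor_add_one ((a / b) / δ)
      rw [div_lt_iff₀ hδ] at this
      linarith
  obtain ⟨T, hTc, hTS⟩ := covering_attained δ hδ _ (mul_finite A)
  rw [← hTc]
  have hpick : ∀ u : ℝ, ∃ i : ℝ, u ∈ ((A : Set ℝ) * (A : Set ℝ)) → i ∈ T ∧ i ≤ u ∧ u ≤ i + δ := by
    intro u
    by_cases hu : u ∈ ((A : Set ℝ) * (A : Set ℝ))
    · have := hTS hu
      simp only [Set.mem_iUnion] at this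
      obtain ⟨i, hi, h2⟩ := this
      exact ⟨i, fun _ => ⟨hi, h2.1, h2.2⟩⟩
    · exact ⟨0, fun h => absurd h hu⟩
  choose pk hpk using hpick
  have hch : ∀ k : ℤ, ∃ q : ℝ × ℝ, k ∈ F → q ∈ A ×ˢ A ∧ ⌊sl q / δ⌋ = k := by
    intro k
    by_cases hk : k ∈ F
    · obtain ⟨q, hq, h2⟩ := Finset.mem_image.1 hk
      exact ⟨q, fun _ => ⟨hq, h2⟩⟩
    · exact ⟨0, fun h => absurd h hk⟩
  choose Q hQ using hch
  have hinj : (F ×ˢ A).card ≤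
      ((T ×ˢ T) ×ˢ (Finset.Ico (0 : ℤ) 4 ×ˢ Finset.Ico (0 : ℤ) 2)).card := by
    apply Finset.card_le_card_of_injOn (fun p => ((pk ((Q p.1).1 * p.2), pk ((Q p.1).2 * p.2)),
      (p.1 % 4, ⌊p.2 / δ⌋ % 2)))
    · rintro ⟨k, t⟩ hp
      rw [Finset.mem_coe, Finset.mem_product] at hp
      obtain ⟨hk, ht⟩ := hp
      simp only at hk ht
      obtain ⟨hq, _⟩ := hQ k hk
      rw [Finset.mem_product] at hq
      simp only [Finset.mem_coe, Finset.mem_product, Finset.mem_Ico]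
      refine ⟨⟨(hpk _ ?_).1, (hpk _ ?_).1⟩, by omega, by omega⟩
      · exact Set.mul_mem_mul hq.1 ht
      · exact Set.mul_mem_mul hq.2 ht
    · rintro ⟨k, t⟩ hp ⟨k', t'⟩ hp' heq
      rw [Finset.mem_coe, Finset.mem_product] at hp hp'
      obtain ⟨hk, ht⟩ := hp
      obtain ⟨hk', ht'⟩ := hp'
      simp only at hk ht hk' ht'
      simp only [Prod.mk.injEq] at heq
      obtain ⟨⟨e1, e2⟩, e3, e4⟩ := heq
      obtain ⟨hq, hfl⟩ := hQ k hk
      obtain ⟨hq', hfl'⟩ := hQ k' hk'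
      rw [Finset.mem_product] at hq hq'
      obtain ⟨_, a1, a2⟩ := hpk _ (Set.mul_mem_mul hq.1 ht)
      obtain ⟨_, a3, a4⟩ := hpk _ (Set.mul_mem_mul hq.2 ht)
      obtain ⟨_, b1, b2⟩ := hpk _ (Set.mul_mem_mul hq'.1 ht')
      obtain ⟨_, b3, b4⟩ := hpk _ (Set.mul_mem_mul hq'.2 ht')
      have c1 := hA hq.1
      have c2 := hA hq.2
      have c1' := hA hq'.1
      have c2' := hA hq'.2
      have ct := hA ht
      have ct' := hA ht'
      rw [Set.mem_Icc] at c1 c2 c1' c2' ct ct'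
      rw [← e1] at b1 b2
      rw [← e2] at b3 b4
      have hu : |(Q k).1 * t - (Q k').1 * t'| ≤ δ := by rw [abs_le]; constructor <;> linarith
      have hv : |(Q k).2 * t - (Q k').2 * t'| ≤ δ := by rw [abs_le]; constructor <;> linarith
      have hsl : |sl (Q k) - sl (Q k')| ≤ 3 * δ := by
        have hpos : 1 ≤ (Q k).2 * t := by nlinarith
        have hx' := sl_bds A hA (Q k') (Finset.mem_product.2 hq')
        have hid : (sl (Q k) - sl (Q k')) * ((Q k).2 * t) =
            ((Q k).1 * t - (Q k').1 * t') - sl (Q k') * ((Q k).2 * t - (Q k').2 * t') := by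
          have n1 : (Q k).2 ≠ 0 := by linarith
          have n2 : (Q k').2 ≠ 0 := by linarith
          unfold sl
          field_simp
          ring
        have hb : |(sl (Q k) - sl (Q k')) * ((Q k).2 * t)| ≤ 3 * δ := by
          rw [hid]
          refine (abs_sub _ _).trans ?_
          rw [abs_mul, abs_of_nonneg (by linarith : 0 ≤ sl (Q k'))]
          nlinarith [abs_nonneg ((Q k).2 * t - (Q k').2 * t')]
        rw [abs_mul, abs_of_nonneg (by linarith : 0 ≤ (Q k).2 * t)] at hb
        nlinarith [abs_nonneg (sl (Q k) - sl (Q k'))]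
      have hkk : k = k' := by
        have d : |sl (Q k) / δ - sl (Q k') / δ| ≤ 3 := by
          rw [← sub_div, abs_div, abs_of_pos hδ, div_le_iff₀ hδ]; exact hsl
        rw [abs_le] at d
        have f1 := Int.floor_le (sl (Q k) / δ)
        have f2 := Int.lt_floor_add_one (sl (Q k) / δ)
        have f3 := Int.floor_le (sl (Q k') / δ)
        have f4 := Int.lt_floor_add_one (sl (Q k') / δ)
        rw [hfl] at f1 f2
        rw [hfl'] at f3 f4
        have g1 : (k : ℝ) < k' + 4 := by linarith [d.2]
        have g2 : (k' : ℝ) < k + 4 := by linarith [d.1]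
        have g1' : k < k' + 4 := by exact_mod_cast g1
        have g2' : k' < k + 4 := by exact_mod_cast g2
        omega
      subst hkk
      have htt : |t - t'| ≤ δ := by
        rw [← mul_sub, abs_mul, abs_of_nonneg (by linarith : 0 ≤ (Q k).1)] at hu
        nlinarith [abs_nonneg (t - t')]
      have htf : ⌊t / δ⌋ = ⌊t' / δ⌋ := by
        have d : |t / δ - t' / δ| ≤ 1 := by
          rw [← sub_div, abs_div, abs_of_pos hδ, div_le_iff₀ hδ]; linarith
        rw [abs_le] at d
        have f1 := Int.floor_le (t / δ)
        have f2 := Int.lt_floor_add_one (t / δ)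
        have f3 := Int.floor_le (t' / δ)
        have f4 := Int.lt_floor_add_one (t' / δ)
        have g1 : (⌊t / δ⌋ : ℝ) < ⌊t' / δ⌋ + 2 := by linarith [d.2]
        have g2 : (⌊t' / δ⌋ : ℝ) < ⌊t / δ⌋ + 2 := by linarith [d.1]
        have g1' : ⌊t / δ⌋ < ⌊t' / δ⌋ + 2 := by exact_mod_cast g1
        have g2' : ⌊t' / δ⌋ < ⌊t / δ⌋ + 2 := by exact_mod_cast g2
        omega
      have hteq : t = t' := by
        by_contra hne
        have g1 := hsep t ht t' ht' hne
        have g2 := Int.abs_sub_lt_one_of_floor_eq_floor htf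
        rw [← sub_div, abs_div, abs_of_pos hδ, div_lt_one hδ] at g2
        linarith
      rw [hteq]
  simp only [Finset.card_product, Int.card_Ico] at hinj
  calc coveringNumber δ (divSet (A : Set ℝ) (A : Set ℝ)) * A.card ≤ F.card * A.card := by gcongr
    _ ≤ _ := hinj
    _ = 8 * T.card ^ 2 := by
      rw [show ((4 : ℤ) - 0).toNat = 4 from rfl, show ((2 : ℤ) - 0).toNat = 2 from rfl]
      ring

lemma covering_pos (δ : ℝ) (hδ : 0 < δ) (S : Set ℝ) (hS : S.Finite) (hne : S.Nonempty) :
    1 ≤ coveringNumber δ S := by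
  obtain ⟨t, htc, htS⟩ := covering_attained δ hδ S hS
  rw [← htc]
  obtain ⟨x, hx⟩ := hne
  have := htS hx
  simp only [Set.mem_iUnion] at this
  obtain ⟨i, hi, _⟩ := this
  exact Finset.card_pos.2 ⟨i, hi⟩

lemma large_delta (σ c K δ0 δ : ℝ) (hσ0 : 0 < σ) (hc : 0 < c) (hK : 1 ≤ K) (hδ0 : 0 < δ0)
    (h : δ0 ≤ δ) (a : ℝ) (ha : a ≤ K * δ ^ (-σ)) (N : ℝ) (hN : 1 ≤ N) :
    δ ^ (-c) * a ≤ (K * δ0 ^ (-σ) * δ0 ^ (-c)) * N := by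
  have hδ : 0 < δ := by linarith
  have h1 : δ ^ (-c) ≤ δ0 ^ (-c) := Real.rpow_le_rpow_of_nonpos hδ0 h (by linarith)
  have h2 : δ ^ (-σ) ≤ δ0 ^ (-σ) := Real.rpow_le_rpow_of_nonpos hδ0 h (by linarith)
  calc δ ^ (-c) * a ≤ δ ^ (-c) * (K * δ ^ (-σ)) := by gcongr
    _ ≤ δ0 ^ (-c) * (K * δ0 ^ (-σ)) := by gcongr
    _ = (K * δ0 ^ (-σ) * δ0 ^ (-c)) * 1 := by ring
    _ ≤ _ := by gcongr

theorem closed_under_addition_case (σ c c' : ℝ) (hσ0 : 0 < σ) (hσ1 : σ < 1)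
    (hc0 : 0 < c) (hc : c < min (σ / 4) ((1 - σ) / 4))
    (hc'0 : 0 < c') (hc' : c' < min (σ / 3) ((1 - σ) / 3))
    (K L : ℝ) (hK : 1 ≤ K) (hL : 1 ≤ L) :
    ∃ C C' : ℝ, 0 < C ∧ 0 < C' ∧ ∀ δ : ℝ, 0 < δ → ∀ A : Finset ℝ,
      (A : Set ℝ) ⊆ Set.Icc 1 2 → IsDeltaSigmaSet K δ σ A →
      ((coveringNumber δ ((A : Set ℝ) + (A : Set ℝ)) : ℝ) ≤ L * (A.card : ℝ) ∨
        (coveringNumber δ ((A : Set ℝ) - (A : Set ℝ)) : ℝ) ≤ L * (A.card : ℝ)) →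
      C * δ ^ (-c) * (A.card : ℝ) ≤
          (coveringNumber δ ((A : Set ℝ) * (A : Set ℝ)) : ℝ) ∧
      C' * δ ^ (-c') * (A.card : ℝ) ≤
          (coveringNumber δ (divSet (A : Set ℝ) (A : Set ℝ)) : ℝ) := by
  rw [lt_min_iff] at hc hc'
  obtain ⟨δ1, hδ1, H1⟩ := div_main σ (2 * c) K L hσ0 hσ1
    (by rw [lt_div_iff₀ (by norm_num), lt_min_iff]; constructor <;> linarith [hc.1, hc.2]) hK hL
  obtain ⟨δ2, hδ2, H2⟩ := div_main σ c' K L hσ0 hσ1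
    (by rw [lt_div_iff₀ (by norm_num), lt_min_iff]; constructor <;> linarith [hc'.1, hc'.2]) hK hL
  have hK0 : 0 < K := by linarith
  set M1 : ℝ := 4 * K + K * δ1 ^ (-σ) * δ1 ^ (-c) with hM1
  set M2 : ℝ := 2 * K + K * δ2 ^ (-σ) * δ2 ^ (-c') with hM2
  have hp1 : 0 < K * δ1 ^ (-σ) * δ1 ^ (-c) := by positivity
  have hp2 : 0 < K * δ2 ^ (-σ) * δ2 ^ (-c') := by positivity
  have hM1p : 0 < M1 := by positivity
  have hM2p : 0 < M2 := by positivity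
  refine ⟨1 / M1, 1 / M2, by positivity, by positivity, ?_⟩
  intro δ hδ A hA hset hcl
  rcases A.eq_empty_or_nonempty with h | hne
  · subst h
    simp
  have hsep := hset.1
  have hcard := hset.2.1
  obtain ⟨a, ha⟩ := id hne
  have hapos : a ≠ 0 := by have := (hA ha).1; intro h; linarith
  have hN1 : (1 : ℝ) ≤ coveringNumber δ ((A : Set ℝ) * (A : Set ℝ)) := by
    exact_mod_cast covering_pos δ hδ _ (mul_finite A) ⟨a * a, Set.mul_mem_mul ha ha⟩
  have hN2 : (1 : ℝ) ≤ coveringNumber δ (divSet (A : Set ℝ) (A : Set ℝ)) := by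
    exact_mod_cast covering_pos δ hδ _ (divSet_finite A) ⟨a / a, a, ha, a, ha, hapos, rfl⟩
  have hApos : 0 < (A.card : ℝ) := by exact_mod_cast hne.card_pos
  constructor
  · rw [mul_assoc, one_div, inv_mul_le_iff₀ hM1p]
    rcases le_total δ1 δ with h | h
    · refine (large_delta σ c K δ1 δ hσ0 hc0 hK hδ1 h _ hcard _ hN1).trans ?_
      gcongr
      linarith
    · have h1 := H1 δ hδ h A hne hA hset hcl
      have h2 : (coveringNumber δ (divSet (A : Set ℝ) (A : Set ℝ)) : ℝ) * A.card ≤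
          8 * (coveringNumber δ ((A : Set ℝ) * (A : Set ℝ)) : ℝ) ^ 2 := by
        exact_mod_cast ruzsa_div A hA δ hδ hsep
      set N := (coveringNumber δ ((A : Set ℝ) * (A : Set ℝ)) : ℝ) with hN
      have h3 : δ ^ (-(2 * c)) = (δ ^ (-c)) ^ 2 := by
        rw [sq, ← Real.rpow_add hδ]; congr 1; ring
      rw [h3] at h1
      have h4 : (δ ^ (-c) * A.card) ^ 2 ≤ (4 * K * N) ^ 2 := by
        calc (δ ^ (-c) * A.card) ^ 2 = ((δ ^ (-c)) ^ 2 * A.card) * A.card := by ring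
          _ ≤ (2 * K * coveringNumber δ (divSet (A : Set ℝ) (A : Set ℝ))) * A.card := by gcongr
          _ = 2 * K * (coveringNumber δ (divSet (A : Set ℝ) (A : Set ℝ)) * A.card) := by ring
          _ ≤ 2 * K * (8 * N ^ 2) := by gcongr
          _ = 16 * N ^ 2 * K := by ring
          _ ≤ 16 * N ^ 2 * K ^ 2 := by
            gcongr
            exact le_self_pow₀ hK (by norm_num)
          _ = _ := by ring
      have h5 := le_of_sq_le_sq h4 (by positivity)
      refine h5.trans ?_
      gcongr
      linarith
  · rw [mul_assoc, one_div, inv_mul_le_iff₀ hM2p]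
    rcases le_total δ2 δ with h | h
    · refine (large_delta σ c' K δ2 δ hσ0 hc'0 hK hδ2 h _ hcard _ hN2).trans ?_
      gcongr
      linarith
    · refine (H2 δ hδ h A hne hA hset hcl).trans ?_
      gcongr
      linarith
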